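/- arXiv:2012.14079 — 2 statements merged into one kernel-verified Lean document; each statement's English description precedes it below -/
import Mathlib

section
/- Suppose n ≥ 17. Let S be a 2-factor of G that is not a tour, containing the path P = {(v1,v2), (v2,v3), (v3,v4)} (v1, v2, v3, v4 distinct) in a cycle C* of S; let C** be a cycle of S distinct from C*; let T′ be a path cover of G with (v2,v3), (v3,v4) ∈ T′ and V1(T′) = V \ {v3}; and let f′ ∈ C** \ T′ be an edge with endpoint q such that T′ ∪ {f′} is a path cover of G. Then there exist four path covers S′1, S′2, T′1, T′2 of G with S′_i ∪ T′_i = S ∪ T′ and S′_i ∩ T′_i = S ∩ T′ for i = 1,2, and pairwise disjoint edge sets A′1, A′2, B′1, B′2 ⊆ E, each disjoint from the corresponding path cover, such that: S′_i ∪ A′_i and T′_i ∪ B′_i are tours of G for i = 1,2; the union C′ = A′1 ∪ A′2 ∪ B′1 ∪ B′2 consists of either one or two cycles and satisfies V(C′) = V \ {v3}; and there exists a cycle D′ with vertex set V \ {v3} such that (q, v2) ∈ D′ and ℓ(D′) ≥ ℓ(C′). -/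
variable {V : Type*} [Fintype V] [DecidableEq V]

/-- The degree of vertex `v` in the edge set `F`. -/
def degE (F : Finset (Sym2 V)) (v : V) : ℕ := (F.filter (fun e => v ∈ e)).card

/-- The set of vertices incident to an edge of `F`. -/
def VsetE (F : Finset (Sym2 V)) : Set V := {v | ∃ e ∈ F, v ∈ e}

/-- Vertices incident to exactly one edge of `F`. -/
def V1E (F : Finset (Sym2 V)) : Set V := {v | degE F v = 1}

/-- Vertices incident to exactly two edges of `F`. -/
def V2E (F : Finset (Sym2 V)) : Set V := {v | degE F v = 2}

/-- All edges are genuine edges of the complete graph (no loops). -/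
def SimpleE (F : Finset (Sym2 V)) : Prop := ∀ e ∈ F, ¬ e.IsDiag

/-- `F` is spanning: every vertex is incident to an edge of `F`. -/
def SpanningE (F : Finset (Sym2 V)) : Prop := VsetE F = Set.univ

/-- `F` is a `k`-matching: every vertex has at most `k` incident edges. -/
def IsKMatching (k : ℕ) (F : Finset (Sym2 V)) : Prop :=
  SimpleE F ∧ ∀ v : V, degE F v ≤ k

/-- `F` is a `k`-factor: every vertex has exactly `k` incident edges. -/
def IsKFactor (k : ℕ) (F : Finset (Sym2 V)) : Prop :=
  SimpleE F ∧ ∀ v : V, degE F v = k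

/-- `F` is the edge set of a single (simple) cycle. -/
def IsCycleE (F : Finset (Sym2 V)) : Prop :=
  ∃ m : ℕ, 3 ≤ m ∧ ∃ f : ℕ → V,
    (∀ i < m, ∀ j < m, f i = f j → i = j) ∧
    F = (Finset.range m).image (fun i => s(f i, f ((i + 1) % m)))

/-- `F` contains no cycle. -/
def AcyclicE (F : Finset (Sym2 V)) : Prop :=
  ∀ C : Finset (Sym2 V), C ⊆ F → ¬ IsCycleE C

/-- `F` is the edge set of a simple path with endpoints `a` and `b`. -/
def IsPathE (F : Finset (Sym2 V)) (a b : V) : Prop :=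
  ∃ m : ℕ, 1 ≤ m ∧ ∃ f : ℕ → V,
    (∀ i ≤ m, ∀ j ≤ m, f i = f j → i = j) ∧ f 0 = a ∧ f m = b ∧
    F = (Finset.range m).image (fun i => s(f i, f (i + 1)))

/-- `P` is a maximal path of `F`, i.e. `P ∈ 𝒫(F)`. -/
def MaxPathE (F P : Finset (Sym2 V)) : Prop :=
  P ⊆ F ∧ (∃ a b : V, IsPathE P a b) ∧
  ∀ e ∈ F, (∃ v : V, v ∈ e ∧ v ∈ VsetE P) → e ∈ P

/-- `F` is a path cover: a spanning acyclic 2-matching. -/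
def IsPathCoverE (F : Finset (Sym2 V)) : Prop :=
  IsKMatching 2 F ∧ SpanningE F ∧ AcyclicE F

/-- `F` is a tour: the edge set of a Hamiltonian cycle. -/
def IsTourE (F : Finset (Sym2 V)) : Prop :=
  IsCycleE F ∧ SpanningE F

/-- Total length of the edge set `F`. -/
def lenE (ℓ : Sym2 V → ℝ) (F : Finset (Sym2 V)) : ℝ := ∑ e ∈ F, ℓ e

/-- Minimum length of a tour. -/
noncomputable def optE (ℓ : Sym2 V → ℝ) : ℝ :=
  sInf {x | ∃ H : Finset (Sym2 V), IsTourE H ∧ lenE ℓ H = x}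

/-- Maximum length of a tour. -/
noncomputable def worE (ℓ : Sym2 V → ℝ) : ℝ :=
  sSup {x | ∃ H : Finset (Sym2 V), IsTourE H ∧ lenE ℓ H = x}

/-- The set of edges of `F` incident to `v`. -/
def deltaE (F : Finset (Sym2 V)) (v : V) : Finset (Sym2 V) :=
  F.filter (fun e => v ∈ e)

/-- `(S, T)` is a valid pair of spanning 2-matchings. -/
def ValidPairE (S T : Finset (Sym2 V)) : Prop :=
  IsKMatching 2 S ∧ IsKMatching 2 T ∧ SpanningE S ∧ SpanningE T ∧
  AcyclicE T ∧
  (∀ v : V, v ∈ V2E S → v ∈ V2E T → deltaE S v = deltaE T v) ∧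
  (∀ C : Finset (Sym2 V), C ⊆ S → IsCycleE C →
    ∀ P : Finset (Sym2 V), MaxPathE T P → VsetE C ≠ VsetE P)

set_option linter.unusedSectionVars false

section Lists

variable {α : Type*}

/-- The multiset of edges between consecutive entries of a list. -/
def pathEdges : List α → Multiset (Sym2 α)
  | [] => 0
  | [_] => 0
  | a :: b :: l => s(a, b) ::ₘ pathEdges (b :: l)

/-- The multiset of edges between cyclically consecutive entries of a list. -/
def cycleEdges : List α → Multiset (Sym2 α)
  | [] => 0
  | a :: l => pathEdges (a :: (l ++ [a]))

@[simp] theorem pathEdges_nil : pathEdges ([] : List α) = 0 := rfl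

@[simp] theorem pathEdges_singleton (a : α) : pathEdges [a] = 0 := rfl

@[simp] theorem pathEdges_cons_cons (a b : α) (l : List α) :
    pathEdges (a :: b :: l) = s(a, b) ::ₘ pathEdges (b :: l) := rfl

theorem pathEdges_append (l₁ : List α) (a : α) (l₂ : List α) :
    pathEdges (l₁ ++ a :: l₂) = pathEdges (l₁ ++ [a]) + pathEdges (a :: l₂) := by
  induction l₁ with
  | nil => simp
  | cons b l₁ ih =>
    cases l₁ with
    | nil => simp
    | cons c l₁ => simpa using ih

theorem pathEdges_append_pair (l : List α) (a b : α) :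
    pathEdges (l ++ [a, b]) = s(a, b) ::ₘ pathEdges (l ++ [a]) := by
  rw [pathEdges_append, pathEdges_cons_cons, pathEdges_singleton, add_comm]
  simp

theorem pathEdges_reverse (l : List α) : pathEdges l.reverse = pathEdges l := by
  induction l with
  | nil => rfl
  | cons a l ih =>
    cases l with
    | nil => rfl
    | cons b l =>
      rw [List.reverse_cons, List.reverse_cons, List.append_assoc, List.singleton_append,
        pathEdges_append_pair, ← List.reverse_cons, ih, pathEdges_cons_cons, Sym2.eq_swap]

theorem cycleEdges_append_comm (l₁ l₂ : List α) :
    cycleEdges (l₁ ++ l₂) = cycleEdges (l₂ ++ l₁) := by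
  cases l₁ with
  | nil => simp
  | cons a l₁ =>
    cases l₂ with
    | nil => simp
    | cons b l₂ =>
      have h1 : cycleEdges (a :: l₁ ++ b :: l₂) =
          pathEdges ((a :: l₁) ++ b :: (l₂ ++ [a])) := by simp [cycleEdges]
      have h2 : cycleEdges (b :: l₂ ++ a :: l₁) =
          pathEdges ((b :: l₂) ++ a :: (l₁ ++ [b])) := by simp [cycleEdges]
      rw [h1, h2, pathEdges_append, pathEdges_append (b :: l₂), add_comm]
      simp

theorem cycleEdges_cons_append_singleton (a : α) (l : List α) (b : α) :
    cycleEdges (a :: (l ++ [b])) = s(b, a) ::ₘ pathEdges (a :: (l ++ [b])) := by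
  have := pathEdges_append_pair (a :: l) b a
  simpa [cycleEdges] using this

theorem mem_of_mem_pathEdges {l : List α} {e : Sym2 α} (he : e ∈ pathEdges l) {v : α}
    (hv : v ∈ e) : v ∈ l := by
  induction l with
  | nil => simp at he
  | cons a l ih =>
    cases l with
    | nil => simp at he
    | cons b l =>
      rw [pathEdges_cons_cons, Multiset.mem_cons] at he
      rcases he with rfl | he
      · rw [Sym2.mem_iff] at hv
        rcases hv with rfl | rfl <;> simp
      · exact List.mem_cons_of_mem _ (ih he)

theorem exists_mem_pathEdges {l : List α} (hl : 2 ≤ l.length) {v : α} (hv : v ∈ l) :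
    ∃ e ∈ pathEdges l, v ∈ e := by
  induction l with
  | nil => simp at hv
  | cons a l ih =>
    cases l with
    | nil => simp at hl
    | cons b l =>
      rcases List.mem_cons.1 hv with rfl | hv
      · exact ⟨s(v, b), by simp, by simp⟩
      · cases l with
        | nil =>
          obtain rfl : v = b := by simpa using hv
          exact ⟨s(a, v), by simp, by simp⟩
        | cons c l =>
          obtain ⟨e, he, hve⟩ := ih (by simp) hv
          exact ⟨e, by rw [pathEdges_cons_cons]; exact Multiset.mem_cons_of_mem he, hve⟩

theorem mem_of_mem_cycleEdges {l : List α} {e : Sym2 α} (he : e ∈ cycleEdges l) {v : α}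
    (hv : v ∈ e) : v ∈ l := by
  cases l with
  | nil => simp [cycleEdges] at he
  | cons a l =>
    have := mem_of_mem_pathEdges he hv
    simp at this ⊢
    tauto

theorem exists_mem_cycleEdges {l : List α} {v : α} (hv : v ∈ l) :
    ∃ e ∈ cycleEdges l, v ∈ e := by
  cases l with
  | nil => simp at hv
  | cons a l =>
    refine exists_mem_pathEdges (by simp) ?_
    simp at hv ⊢
    tauto

theorem nodup_pathEdges {l : List α} (hl : l.Nodup) : (pathEdges l).Nodup := by
  induction l with
  | nil => simp
  | cons a l ih =>
    cases l with
    | nil => simp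
    | cons b l =>
      rw [pathEdges_cons_cons, Multiset.nodup_cons]
      refine ⟨fun h => ?_, ih (List.nodup_cons.1 hl).2⟩
      exact (List.nodup_cons.1 hl).1 (mem_of_mem_pathEdges h (Sym2.mem_mk_left a b))

theorem not_isDiag_of_mem_pathEdges {l : List α} (hl : l.Nodup) {e : Sym2 α}
    (he : e ∈ pathEdges l) : ¬ e.IsDiag := by
  induction l with
  | nil => simp at he
  | cons a l ih =>
    cases l with
    | nil => simp at he
    | cons b l =>
      rw [pathEdges_cons_cons, Multiset.mem_cons] at he
      rcases he with rfl | he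
      · rw [Sym2.mk_isDiag_iff]
        rintro rfl
        simp at hl
      · exact ih (List.nodup_cons.1 hl).2 he

/-- In a path, the only edge at the first vertex is the first edge. -/
theorem eq_of_mem_pathEdges_of_mem_head {a b : α} {l : List α} (hl : (a :: b :: l).Nodup)
    {e : Sym2 α} (he : e ∈ pathEdges (a :: b :: l)) (ha : a ∈ e) : e = s(a, b) := by
  rw [pathEdges_cons_cons, Multiset.mem_cons] at he
  exact he.resolve_right fun h => (List.nodup_cons.1 hl).1 (mem_of_mem_pathEdges h ha)

/-- A list with at least three entries has the form `a :: b :: (m ++ [c])`. -/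
theorem exists_eq_of_three_le_length {l : List α} (h : 3 ≤ l.length) :
    ∃ a b m c, l = a :: b :: (m ++ [c]) := by
  match l, h with
  | a :: b :: c :: t, _ =>
    obtain ⟨m, d, hd⟩ : ∃ m d, c :: t = m ++ [d] :=
      ⟨(c :: t).dropLast, (c :: t).getLast (by simp),
        (List.dropLast_append_getLast (by simp)).symm⟩
    exact ⟨a, b, m, d, by rw [hd]⟩

theorem nodup_cycleEdges {l : List α} (hl : l.Nodup) (h3 : 3 ≤ l.length) :
    (cycleEdges l).Nodup := by
  obtain ⟨a, b, m, c, rfl⟩ := exists_eq_of_three_le_length h3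
  have h := cycleEdges_cons_append_singleton a (b :: m) c
  simp only [List.cons_append] at h
  rw [h, Multiset.nodup_cons]
  refine ⟨fun he => ?_, nodup_pathEdges hl⟩
  have := eq_of_mem_pathEdges_of_mem_head hl he (Sym2.mem_mk_right c a)
  rw [Sym2.eq_swap, Sym2.congr_right] at this
  subst this
  simp at hl

theorem not_isDiag_of_mem_cycleEdges {l : List α} (hl : l.Nodup) (h3 : 3 ≤ l.length)
    {e : Sym2 α} (he : e ∈ cycleEdges l) : ¬ e.IsDiag := by
  obtain ⟨a, b, m, c, rfl⟩ := exists_eq_of_three_le_length h3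
  have h := cycleEdges_cons_append_singleton a (b :: m) c
  simp only [List.cons_append] at h
  rw [h, Multiset.mem_cons] at he
  rcases he with rfl | he
  · rw [Sym2.mk_isDiag_iff]
    rintro rfl
    simp at hl
  · exact not_isDiag_of_mem_pathEdges hl he

/-- Rotating a cycle so that it starts at a given vertex. -/
theorem exists_cycleEdges_eq_of_mem {l : List α} {v : α} (hv : v ∈ l) :
    ∃ t, l.Perm (v :: t) ∧ cycleEdges l = cycleEdges (v :: t) := by
  obtain ⟨l₁, l₂, rfl⟩ := List.append_of_mem hv
  exact ⟨l₂ ++ l₁, List.perm_append_comm, cycleEdges_append_comm _ _⟩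

/-- Removing an edge from a cycle leaves a path between the endpoints of that edge. -/
theorem exists_path_of_mem_cycleEdges {l : List α} (hl : l.Nodup) (h3 : 3 ≤ l.length)
    {x y : α} (he : s(x, y) ∈ cycleEdges l) :
    ∃ m, l.Perm (x :: (m ++ [y])) ∧
      cycleEdges l = s(x, y) ::ₘ pathEdges (x :: (m ++ [y])) := by
  have hx : x ∈ l := mem_of_mem_cycleEdges he (Sym2.mem_mk_left x y)
  obtain ⟨t, hp, hc⟩ := exists_cycleEdges_eq_of_mem hx
  have hn := hp.nodup hl
  have hlen := hp.length_eq ▸ h3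
  obtain ⟨a, b, m, c, h⟩ := exists_eq_of_three_le_length hlen
  obtain ⟨rfl, rfl⟩ := List.cons.inj h
  have h' := cycleEdges_cons_append_singleton x (b :: m) c
  simp only [List.cons_append] at h'
  rw [hc, h', Multiset.mem_cons] at he
  rcases he with he | he
  · rw [Sym2.eq_swap, Sym2.congr_left] at he
    subst he
    exact ⟨b :: m, hp, by rw [hc, h', Sym2.eq_swap]; rfl⟩
  · have := eq_of_mem_pathEdges_of_mem_head hn he (Sym2.mem_mk_left x y)
    rw [Sym2.congr_right] at this
    subst this
    refine ⟨(m ++ [c]).reverse, hp.trans ?_, ?_⟩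
    · refine List.Perm.cons _ ?_
      refine (List.reverse_perm (y :: (m ++ [c]))).symm.trans ?_
      rw [List.reverse_cons]
    · rw [hc]
      have : x :: ((m ++ [c]).reverse ++ [y]) = (y :: ((m ++ [c]) ++ [x])).reverse := by simp
      rw [this, pathEdges_reverse]
      rfl

end Lists

theorem pathEdges_map_range {α : Type*} (f : ℕ → α) (m : ℕ) :
    pathEdges ((List.range (m + 1)).map f) =
      (Multiset.range m).map (fun i => s(f i, f (i + 1))) := by
  induction m with
  | zero => simp
  | succ m ih =>
    have : (List.range (m + 1 + 1)).map f = (List.range m).map f ++ [f m, f (m + 1)] := by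
      simp [List.range_succ]
    rw [this, pathEdges_append_pair, Multiset.range_succ, Multiset.map_cons, ← ih]
    simp [List.range_succ]

theorem cycleEdges_map_range {α : Type*} (f : ℕ → α) {m : ℕ} (hm : 0 < m) :
    cycleEdges ((List.range m).map f) =
      (Multiset.range m).map (fun i => s(f i, f ((i + 1) % m))) := by
  have h1 : cycleEdges ((List.range m).map f) =
      pathEdges ((List.range (m + 1)).map (fun i => f (i % m))) := by
    obtain ⟨k, rfl⟩ : ∃ k, m = k + 1 := ⟨m - 1, by omega⟩
    have h2 : (List.range (k + 1)).map (fun i => f (i % (k + 1))) =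
        (List.range (k + 1)).map f := by
      refine List.map_congr_left fun i hi => ?_
      rw [Nat.mod_eq_of_lt (List.mem_range.1 hi)]
    rw [List.range_succ (n := k + 1), List.map_append, h2, List.range_succ_eq_map]
    simp [cycleEdges]
  rw [h1, pathEdges_map_range]
  refine Multiset.map_congr rfl fun i hi => ?_
  rw [Nat.mod_eq_of_lt (Multiset.mem_range.1 hi)]

/-- A set of edges is a cycle iff it is the edge set of a cyclic list of distinct vertices. -/
theorem isCycleE_iff {C : Finset (Sym2 V)} :
    IsCycleE C ↔ ∃ l : List V, l.Nodup ∧ 3 ≤ l.length ∧ C.val = cycleEdges l := by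
  constructor
  · rintro ⟨m, hm, f, hf, rfl⟩
    have hn : ((List.range m).map f).Nodup :=
      List.Nodup.map_on (fun i hi j hj h => hf i (List.mem_range.1 hi) j (List.mem_range.1 hj) h)
        List.nodup_range
    have hl : 3 ≤ ((List.range m).map f).length := by simpa using hm
    refine ⟨_, hn, hl, ?_⟩
    have hc := nodup_cycleEdges hn hl
    rw [cycleEdges_map_range f (by omega)] at hc ⊢
    rw [Finset.image_val, Finset.range_val]
    exact Multiset.dedup_eq_self.2 hc
  · rintro ⟨l, hn, hl, hC⟩
    obtain ⟨a, l', rfl⟩ : ∃ a l', l = a :: l' := by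
      cases l with
      | nil => simp at hl
      | cons a l' => exact ⟨a, l', rfl⟩
    set l := a :: l'
    have hmap : (List.range l.length).map (fun i => l.getD i a) = l := by
      refine List.ext_getElem (by simp) fun i h1 h2 => ?_
      simp [h2]
    refine ⟨l.length, hl, fun i => l.getD i a, fun i hi j hj h => ?_, ?_⟩
    · simp only [List.getD_eq_getElem _ _ hi, List.getD_eq_getElem _ _ hj] at h
      exact (List.Nodup.getElem_inj_iff hn).1 h
    · have h := cycleEdges_map_range (fun i => l.getD i a) (m := l.length) (by omega)
      rw [hmap] at h
      have hc := nodup_cycleEdges hn hl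
      apply Finset.val_injective
      rw [hC, h, Finset.image_val, Finset.range_val]
      rw [h] at hc
      exact (Multiset.dedup_eq_self.2 hc).symm

theorem degE_eq_countP (F : Finset (Sym2 V)) (v : V) :
    degE F v = F.val.countP (fun e => v ∈ e) := by
  rw [Multiset.countP_eq_card_filter]
  rfl

theorem countP_mem_cycleEdges {l : List V} (hl : l.Nodup) (h3 : 3 ≤ l.length) (v : V) :
    (cycleEdges l).countP (fun e => v ∈ e) = if v ∈ l then 2 else 0 := by
  split_ifs with hv
  · obtain ⟨t, hp, hc⟩ := exists_cycleEdges_eq_of_mem hv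
    have hn := hp.nodup hl
    obtain ⟨a, b, m, c, h⟩ := exists_eq_of_three_le_length (hp.length_eq ▸ h3)
    obtain ⟨rfl, rfl⟩ := List.cons.inj h
    have h' := cycleEdges_cons_append_singleton v (b :: m) c
    simp only [List.cons_append] at h'
    rw [hc, h', pathEdges_cons_cons, Multiset.countP_cons_of_pos _ (by simp),
      Multiset.countP_cons_of_pos _ (by simp)]
    rw [Multiset.countP_eq_zero.2]
    exact fun e he hve => (List.nodup_cons.1 hn).1 (mem_of_mem_pathEdges he hve)
  · exact Multiset.countP_eq_zero.2 fun e he hve => hv (mem_of_mem_cycleEdges he hve)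

theorem degE_le_of_subset {F F' : Finset (Sym2 V)} (h : F ⊆ F') (v : V) :
    degE F v ≤ degE F' v :=
  Finset.card_le_card (Finset.filter_subset_filter _ h)

theorem degE_sdiff {F C : Finset (Sym2 V)} (h : C ⊆ F) (v : V) :
    degE (F \ C) v = degE F v - degE C v := by
  unfold degE
  rw [← Finset.card_sdiff_of_subset (Finset.filter_subset_filter _ h)]
  congr 1
  ext e
  simp only [Finset.mem_filter, Finset.mem_sdiff]
  tauto

theorem degE_pos_of_mem {F : Finset (Sym2 V)} {e : Sym2 V} (he : e ∈ F) {v : V} (hv : v ∈ e) :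
    0 < degE F v :=
  Finset.card_pos.2 ⟨e, Finset.mem_filter.2 ⟨he, hv⟩⟩

/-- If the degree of `v` in `F` does not exceed its degree in a subset `C`, then every edge of
`F` at `v` lies in `C`. -/
theorem mem_of_degE_le {F C : Finset (Sym2 V)} (h : C ⊆ F) {v : V} (hd : degE F v ≤ degE C v)
    {e : Sym2 V} (he : e ∈ F) (hv : v ∈ e) : e ∈ C := by
  have := Finset.eq_of_subset_of_card_le (Finset.filter_subset_filter (fun e => v ∈ e) h) hd
  have h2 : e ∈ F.filter (fun e => v ∈ e) := Finset.mem_filter.2 ⟨he, hv⟩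
  rw [← this] at h2
  exact (Finset.mem_filter.1 h2).1

theorem degE_eq_of_val_eq {C : Finset (Sym2 V)} {l : List V} (hl : l.Nodup) (h3 : 3 ≤ l.length)
    (hC : C.val = cycleEdges l) (v : V) : degE C v = if v ∈ l then 2 else 0 := by
  rw [degE_eq_countP, hC, countP_mem_cycleEdges hl h3]

/-- A path contains no cycle. -/
theorem acyclicE_of_subset_pathEdges {l : List V} (hl : l.Nodup) {F : Finset (Sym2 V)}
    (hF : ∀ e ∈ F, e ∈ pathEdges l) : AcyclicE F := by
  intro C hCF hC
  replace hF : ∀ e ∈ C, e ∈ pathEdges l := fun e he => hF e (hCF he)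
  obtain ⟨t, ht, h3, hCt⟩ := isCycleE_iff.1 hC
  induction l with
  | nil =>
    obtain ⟨a, b, m, c, rfl⟩ := exists_eq_of_three_le_length h3
    have : s(a, b) ∈ C := by
      rw [← Finset.mem_val, hCt]
      simp [cycleEdges]
    simpa using hF _ this
  | cons a l ih =>
    refine ih (List.nodup_cons.1 hl).2 fun e he => ?_
    cases l with
    | nil => simpa using hF e he
    | cons b l =>
      have ha : degE C a < 2 := by
        refine lt_of_le_of_lt (Finset.card_le_one.2 fun e he e' he' => ?_) one_lt_two
        rw [Finset.mem_filter] at he he'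
        rw [eq_of_mem_pathEdges_of_mem_head hl (hF _ he.1) he.2,
          eq_of_mem_pathEdges_of_mem_head hl (hF _ he'.1) he'.2]
      rw [degE_eq_of_val_eq ht h3 hCt] at ha
      have hat : a ∉ t := fun h => by simp [h] at ha
      have := hF e he
      rw [pathEdges_cons_cons, Multiset.mem_cons] at this
      refine this.resolve_left ?_
      rintro rfl
      rw [← Finset.mem_val, hCt] at he
      exact hat (mem_of_mem_cycleEdges he (Sym2.mem_mk_left a b))

/-- A spanning set of edges obtained from a Hamiltonian cycle by removing at least one edge is a
path cover. -/
theorem isPathCoverE_of_val_add_eq_cycleEdges {F : Finset (Sym2 V)} {A : Multiset (Sym2 V)}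
    {l : List V} (hl : l.Nodup) (h3 : 3 ≤ l.length) (h : F.val + A = cycleEdges l) (hA : A ≠ 0)
    (hF : ∀ v, ∃ e ∈ F, v ∈ e) : IsPathCoverE F := by
  have hsub : ∀ e ∈ F, e ∈ cycleEdges l := fun e he => by
    rw [← h]
    exact Multiset.mem_add.2 (Or.inl he)
  refine ⟨⟨fun e he => not_isDiag_of_mem_cycleEdges hl h3 (hsub e he), fun v => ?_⟩,
    Set.eq_univ_of_forall hF, ?_⟩
  · have := countP_mem_cycleEdges hl h3 v
    rw [← h, Multiset.countP_add] at this
    rw [degE_eq_countP]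
    split_ifs at this <;> omega
  · obtain ⟨e, he⟩ := Multiset.exists_mem_of_ne_zero hA
    induction e with
    | h x y =>
      have hel : s(x, y) ∈ cycleEdges l := by
        rw [← h]
        exact Multiset.mem_add.2 (Or.inr he)
      obtain ⟨m, hp, hc⟩ := exists_path_of_mem_cycleEdges hl h3 hel
      refine acyclicE_of_subset_pathEdges (hp.nodup hl) fun e' he' => ?_
      have := hsub e' he'
      rw [hc, Multiset.mem_cons] at this
      refine this.resolve_left ?_
      rintro rfl
      have hn := nodup_cycleEdges hl h3
      rw [← h, Multiset.nodup_add] at hn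
      exact Multiset.disjoint_left.1 hn.2.2 he' he

theorem mem_of_forall_mem_pathEdges {α : Type*} {l : List α} {a : α} {K : Set α} (ha : a ∈ K)
    (h : ∀ x y, s(x, y) ∈ pathEdges (a :: l) → x ∈ K → y ∈ K) : ∀ v ∈ a :: l, v ∈ K := by
  induction l generalizing a with
  | nil => simpa using ha
  | cons b l ih =>
    intro v hv
    rcases List.mem_cons.1 hv with rfl | hv
    · exact ha
    · refine ih (h a b (by simp) ha) (fun x y hxy => h x y ?_) v hv
      rw [pathEdges_cons_cons]
      exact Multiset.mem_cons_of_mem hxy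

/-- Two cycles of a set of edges of maximum degree two that share a vertex are nested. -/
theorem subset_of_isCycleE {F C C' : Finset (Sym2 V)} {l l' : List V} (hF : ∀ v, degE F v ≤ 2)
    (hCF : C ⊆ F) (hCF' : C' ⊆ F) (hC : C.val = cycleEdges l) (hl' : l'.Nodup) (h3' : 3 ≤ l'.length)
    (hC' : C'.val = cycleEdges l') {v : V} (hv : v ∈ l) (hv' : v ∈ l') : C ⊆ C' := by
  obtain ⟨t, hp, hc⟩ := exists_cycleEdges_eq_of_mem hv
  have key : ∀ x ∈ l', ∀ e ∈ C, x ∈ e → e ∈ C' := fun x hx e he hxe => by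
    refine mem_of_degE_le hCF' ?_ (hCF he) hxe
    rw [degE_eq_of_val_eq hl' h3' hC', if_pos hx]
    exact hF x
  have hall := mem_of_forall_mem_pathEdges (l := t ++ [v]) (K := {x | x ∈ l'}) hv'
    fun x y hxy hx => by
      have hm : s(x, y) ∈ C := by
        rw [← Finset.mem_val, hC, hc]
        exact hxy
      have := key x hx _ hm (Sym2.mem_mk_left x y)
      rw [← Finset.mem_val, hC'] at this
      exact mem_of_mem_cycleEdges this (Sym2.mem_mk_right x y)
  intro e he
  induction e with
  | h x y =>
    have hxl : x ∈ l := by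
      have h := he
      rw [← Finset.mem_val, hC] at h
      exact mem_of_mem_cycleEdges h (Sym2.mem_mk_left x y)
    refine key x (hall x ?_) _ he (Sym2.mem_mk_left x y)
    have := hp.mem_iff.1 hxl
    simp at this ⊢
    tauto

/-- A nonempty set of edges with all degrees zero or two contains a cycle. -/
theorem exists_cycleEdges_subset {F : Finset (Sym2 V)} (hs : SimpleE F)
    (hd : ∀ v, degE F v = 0 ∨ degE F v = 2) (hF : F.Nonempty) :
    ∃ l : List V, l.Nodup ∧ 3 ≤ l.length ∧ ∀ e ∈ cycleEdges l, e ∈ F := by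
  by_contra! hcon
  have key : ∀ n, ∃ l : List V, l.Nodup ∧ l.length = n + 2 ∧ ∀ e ∈ pathEdges l, e ∈ F := by
    intro n
    induction n with
    | zero =>
      obtain ⟨e, he⟩ := hF
      induction e with
      | h x y =>
        have := hs _ he
        rw [Sym2.mk_isDiag_iff] at this
        exact ⟨[x, y], by simpa using this, rfl, by simpa using he⟩
    | succ n ih =>
      obtain ⟨l, hn, hlen, hl⟩ := ih
      match l, hlen with
      | a :: b :: l, hlen =>
        have hab : s(a, b) ∈ F := hl _ (by simp)
        have h2 : degE F a = 2 :=
          (hd a).resolve_left (degE_pos_of_mem hab (Sym2.mem_mk_left a b)).ne'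
        obtain ⟨e, he, hne⟩ := Finset.exists_mem_ne (s := F.filter (fun e => a ∈ e))
          (by rw [degE] at h2; omega) s(a, b)
        obtain ⟨he, hae⟩ := Finset.mem_filter.1 he
        obtain ⟨c, rfl⟩ := Sym2.mem_iff_exists.1 hae
        have hcb : c ≠ b := by
          rintro rfl
          exact hne rfl
        have hca : c ≠ a := by
          rintro rfl
          exact hs _ he (by simp)
        by_cases hc : c ∈ l
        · obtain ⟨l₁, l₂, rfl⟩ := List.append_of_mem hc
          exfalso
          have hsub : (a :: b :: (l₁ ++ [c])).Nodup := by
            refine hn.sublist ?_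
            simp
          obtain ⟨e, he1, he2⟩ := hcon _ hsub (by simp)
          have h' := cycleEdges_cons_append_singleton a (b :: l₁) c
          simp only [List.cons_append] at h'
          rw [h', Multiset.mem_cons] at he1
          rcases he1 with rfl | he1
          · rw [Sym2.eq_swap] at he2
            exact he2 he
          · refine he2 (hl _ ?_)
            have := pathEdges_append (a :: b :: l₁) c l₂
            simp only [List.cons_append] at this
            rw [this]
            exact Multiset.mem_add.2 (Or.inl he1)
        · refine ⟨c :: a :: b :: l, ?_, by simpa using hlen, fun e he' => ?_⟩
          · refine List.nodup_cons.2 ⟨?_, hn⟩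
            simp [hca, hcb, hc]
          · rw [pathEdges_cons_cons, Multiset.mem_cons] at he'
            rcases he' with rfl | he'
            · rwa [Sym2.eq_swap]
            · exact hl _ he'
  obtain ⟨l, hn, hlen, -⟩ := key (Fintype.card V)
  have := hn.length_le_card
  omega

/-- A path with at least two vertices, given by its two endpoints and the list of its inner
vertices. -/
structure EndedPath (α : Type*) where
  /-- The first vertex. -/
  fst : α
  /-- The inner vertices. -/
  mid : List α
  /-- The last vertex. -/
  lst : α

namespace EndedPath

variable {α : Type*}

/-- The list of vertices of a path. -/
def verts (p : EndedPath α) : List α := p.fst :: (p.mid ++ [p.lst])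

/-- The reversed path. -/
def rev (p : EndedPath α) : EndedPath α := ⟨p.lst, p.mid.reverse, p.fst⟩

/-- The edges of a path. -/
def edges (p : EndedPath α) : Multiset (Sym2 α) := pathEdges p.verts

/-- The two endpoints of a path. -/
def ends (p : EndedPath α) : Multiset α := {p.fst, p.lst}

/-- All edges of a family of paths. -/
def edgeSum (P : Multiset (EndedPath α)) : Multiset (Sym2 α) := (P.map edges).sum

/-- All vertices of a family of paths. -/
def vertSum (P : Multiset (EndedPath α)) : Multiset α :=
  (P.map fun p => (p.verts : Multiset α)).sum

/-- All endpoints of a family of paths. -/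
def endSum (P : Multiset (EndedPath α)) : Multiset α := (P.map ends).sum

theorem verts_rev (p : EndedPath α) : p.rev.verts = p.verts.reverse := by simp [rev, verts]

theorem coe_verts_rev (p : EndedPath α) :
    (p.rev.verts : Multiset α) = (p.verts : Multiset α) := by
  rw [verts_rev]
  exact Multiset.coe_reverse _

theorem edges_rev (p : EndedPath α) : p.rev.edges = p.edges := by
  rw [edges, verts_rev, pathEdges_reverse, edges]

theorem ends_rev (p : EndedPath α) : p.rev.ends = p.ends :=
  Multiset.pair_comm _ _

@[simp] theorem edgeSum_zero : edgeSum (0 : Multiset (EndedPath α)) = 0 := rfl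

@[simp] theorem vertSum_zero : vertSum (0 : Multiset (EndedPath α)) = 0 := rfl

@[simp] theorem endSum_zero : endSum (0 : Multiset (EndedPath α)) = 0 := rfl

@[simp] theorem edgeSum_cons (p : EndedPath α) (P : Multiset (EndedPath α)) :
    edgeSum (p ::ₘ P) = p.edges + edgeSum P := by simp [edgeSum]

@[simp] theorem vertSum_cons (p : EndedPath α) (P : Multiset (EndedPath α)) :
    vertSum (p ::ₘ P) = (p.verts : Multiset α) + vertSum P := by simp [vertSum]

@[simp] theorem endSum_cons (p : EndedPath α) (P : Multiset (EndedPath α)) :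
    endSum (p ::ₘ P) = p.ends + endSum P := by simp [endSum]

@[simp] theorem edgeSum_singleton (p : EndedPath α) : edgeSum {p} = p.edges := by simp [edgeSum]

@[simp] theorem vertSum_singleton (p : EndedPath α) :
    vertSum {p} = (p.verts : Multiset α) := by simp [vertSum]

theorem edgeSum_add (P Q : Multiset (EndedPath α)) :
    edgeSum (P + Q) = edgeSum P + edgeSum Q := by simp [edgeSum]

theorem vertSum_add (P Q : Multiset (EndedPath α)) :
    vertSum (P + Q) = vertSum P + vertSum Q := by simp [vertSum]

theorem edgeSum_map_rev (P : Multiset (EndedPath α)) : edgeSum (P.map rev) = edgeSum P := by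
  simp [edgeSum, edges_rev]

theorem vertSum_map_rev (P : Multiset (EndedPath α)) : vertSum (P.map rev) = vertSum P := by
  simp [vertSum, coe_verts_rev]

theorem ends_le_verts (p : EndedPath α) : p.ends ≤ (p.verts : Multiset α) := by
  have : (p.verts : Multiset α) = p.ends + p.mid := by
    refine Multiset.coe_eq_coe.2 (List.Perm.cons _ ?_)
    exact List.perm_append_singleton _ _
  rw [this]
  exact Multiset.le_add_right _ _

theorem endSum_le_vertSum (P : Multiset (EndedPath α)) : endSum P ≤ vertSum P := by
  induction P using Multiset.induction with
  | empty => simp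
  | cons p P ih =>
    rw [endSum_cons, vertSum_cons]
    exact add_le_add p.ends_le_verts ih

theorem mem_ends {p : EndedPath α} {v : α} : v ∈ p.ends ↔ v = p.fst ∨ v = p.lst := by
  simp [ends]

theorem mem_endSum {P : Multiset (EndedPath α)} {v : α} :
    v ∈ endSum P ↔ ∃ p ∈ P, v ∈ p.ends := by
  induction P using Multiset.induction with
  | empty => simp
  | cons p P ih => simp [ih]

theorem exists_mem_edgeSum {P : Multiset (EndedPath α)} {v : α} (hv : v ∈ vertSum P) :
    ∃ e ∈ edgeSum P, v ∈ e := by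
  induction P using Multiset.induction with
  | empty => simp at hv
  | cons p P ih =>
    rw [vertSum_cons, Multiset.mem_add] at hv
    rw [edgeSum_cons]
    rcases hv with hv | hv
    · obtain ⟨e, he, hve⟩ := exists_mem_pathEdges (l := p.verts) (by simp [verts])
        (Multiset.mem_coe.1 hv)
      exact ⟨e, Multiset.mem_add.2 (Or.inl he), hve⟩
    · obtain ⟨e, he, hve⟩ := ih hv
      exact ⟨e, Multiset.mem_add.2 (Or.inr he), hve⟩

/-- A path can be oriented so that it ends at a given one of its endpoints. -/
theorem exists_lst_eq {p : EndedPath α} {v : α} (hv : v ∈ p.ends) :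
    ∃ p' : EndedPath α, p'.lst = v ∧ p'.edges = p.edges ∧
      (p'.verts : Multiset α) = (p.verts : Multiset α) ∧ p'.ends = p.ends := by
  rcases mem_ends.1 hv with rfl | rfl
  · exact ⟨p.rev, rfl, p.edges_rev, p.coe_verts_rev, p.ends_rev⟩
  · exact ⟨p, rfl, rfl, rfl, rfl⟩

theorem exists_cons_lst_eq {P : Multiset (EndedPath α)} {v : α} (hv : v ∈ endSum P) :
    ∃ (p : EndedPath α) (Q : Multiset (EndedPath α)), p.lst = v ∧
      edgeSum (p ::ₘ Q) = edgeSum P ∧ vertSum (p ::ₘ Q) = vertSum P ∧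
      endSum (p ::ₘ Q) = endSum P := by
  obtain ⟨p, hp, hvp⟩ := mem_endSum.1 hv
  obtain ⟨Q, rfl⟩ := Multiset.exists_cons_of_mem hp
  obtain ⟨p', h1, h2, h3, h4⟩ := exists_lst_eq hvp
  exact ⟨p', Q, h1, by simp [h2], by simp [h3], by simp [h4]⟩

/-- Joining two different paths of a family by an edge between endpoints. -/
theorem exists_join {P : Multiset (EndedPath α)} {u w : α} (hu : u ∈ endSum P)
    (hw : w ∈ endSum P) (h : ∀ p ∈ P, u ∈ p.ends → w ∉ p.ends) :
    ∃ Q : Multiset (EndedPath α), edgeSum Q = s(u, w) ::ₘ edgeSum P ∧ vertSum Q = vertSum P ∧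
      u ::ₘ w ::ₘ endSum Q = endSum P := by
  obtain ⟨p, hp, hup⟩ := mem_endSum.1 hu
  obtain ⟨p', hp', hwp⟩ := mem_endSum.1 hw
  obtain ⟨P₁, rfl⟩ := Multiset.exists_cons_of_mem hp
  have hp₁ : p' ∈ P₁ := by
    refine (Multiset.mem_cons.1 hp').resolve_left ?_
    rintro rfl
    exact h p' hp hup hwp
  obtain ⟨P₂, rfl⟩ := Multiset.exists_cons_of_mem hp₁
  obtain ⟨⟨a, m, u⟩, rfl, h2, h3, h4⟩ := exists_lst_eq hup
  obtain ⟨⟨b, m', w⟩, rfl, h2', h3', h4'⟩ := exists_lst_eq hwp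
  refine ⟨⟨a, m ++ u :: w :: m'.reverse, b⟩ ::ₘ P₂, ?_, ?_, ?_⟩
  · have e1 : edges ⟨a, m ++ u :: w :: m'.reverse, b⟩ =
        s(u, w) ::ₘ (edges ⟨a, m, u⟩ + edges ⟨b, m', w⟩) := by
      rw [← edges_rev ⟨b, m', w⟩]
      have := pathEdges_append (a :: m) u (w :: (m'.reverse ++ [b]))
      simp only [List.cons_append] at this
      simp only [edges, verts, rev, List.append_assoc, List.cons_append]
      rw [this, pathEdges_cons_cons, Multiset.add_cons]
    simp only [edgeSum_cons, e1, h2, h2', Multiset.cons_add, add_assoc]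
  · simp only [vertSum_cons, ← h3, ← h3', ← add_assoc]
    congr 1
    rw [← coe_verts_rev ⟨b, m', w⟩, Multiset.coe_add]
    simp [verts, rev]
  · rw [endSum_cons, endSum_cons, endSum_cons, ← h4, ← h4']
    simp only [ends, Multiset.insert_eq_cons, ← Multiset.singleton_add]
    abel

/-- A cycle whose vertices are all endpoints of a family of paths has an edge joining two
different paths. -/
theorem exists_joining_edge {P : Multiset (EndedPath α)} (hP : (endSum P).Nodup) {l : List α}
    (hl : l.Nodup) (h3 : 3 ≤ l.length) (hlP : ∀ v ∈ l, v ∈ endSum P) :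
    ∃ p : EndedPath α, l.Perm p.verts ∧ cycleEdges l = s(p.fst, p.lst) ::ₘ p.edges ∧
      ∀ r ∈ P, p.fst ∈ r.ends → p.lst ∉ r.ends := by
  obtain ⟨u, w, m, w', rfl⟩ := exists_eq_of_three_le_length h3
  obtain ⟨r, hr, hur⟩ := mem_endSum.1 (hlP u (by simp))
  have huniq : ∀ r' ∈ P, u ∈ r'.ends → r' = r := by
    intro r' hr' hur'
    obtain ⟨P₁, rfl⟩ := Multiset.exists_cons_of_mem hr
    refine (Multiset.mem_cons.1 hr').resolve_right fun hr₁ => ?_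
    rw [endSum_cons, Multiset.nodup_add] at hP
    exact Multiset.disjoint_left.1 hP.2.2 hur (mem_endSum.2 ⟨r', hr₁, hur'⟩)
  by_cases hw : w ∈ r.ends
  · refine ⟨⟨u, w :: m, w'⟩, by simp [verts], ?_, ?_⟩
    · have := cycleEdges_cons_append_singleton u (w :: m) w'
      simp only [List.cons_append] at this
      rw [this, Sym2.eq_swap]
      rfl
    · intro r' hr' hu hw'
      obtain rfl := huniq r' hr' hu
      simp only [mem_ends] at hur hw hw'
      simp only [List.nodup_cons, List.mem_cons, List.mem_append] at hl
      grind
  · refine ⟨⟨u, (m ++ [w']).reverse, w⟩, ?_, ?_, ?_⟩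
    · refine List.Perm.cons _ ?_
      refine (List.reverse_perm (w :: (m ++ [w']))).symm.trans ?_
      rw [List.reverse_cons]
    · have : u :: ((m ++ [w']).reverse ++ [w]) = (w :: ((m ++ [w']) ++ [u])).reverse := by simp
      simp only [edges, verts]
      rw [this, pathEdges_reverse]
      rfl
    · intro r' hr' hu
      obtain rfl := huniq r' hr' hu
      exact hw

/-- The concatenation of a list of paths. -/
def flat (ps : List (EndedPath α)) : List α := ps.flatMap verts

/-- The edges linking consecutive paths of a list, starting at `c` and arriving at `d`. -/
def links : α → List (EndedPath α) → α → Multiset (Sym2 α)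
  | c, [], d => {s(c, d)}
  | c, p :: ps, d => s(c, p.fst) ::ₘ links p.lst ps d

theorem coe_flat (ps : List (EndedPath α)) : (flat ps : Multiset α) = vertSum ps := by
  induction ps with
  | nil => rfl
  | cons p ps ih =>
    rw [← Multiset.cons_coe, vertSum_cons, ← ih, Multiset.coe_add]
    rfl

theorem links_ne_zero (c : α) (ps : List (EndedPath α)) (d : α) : links c ps d ≠ 0 := by
  cases ps <;> simp [links]

theorem links_append_singleton (c : α) (ps : List (EndedPath α)) (p : EndedPath α) (d : α) :
    links c (ps ++ [p]) d = s(p.lst, d) ::ₘ links c ps p.fst := by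
  induction ps generalizing c with
  | nil => exact Multiset.pair_comm _ _
  | cons p' ps ih => simp only [List.cons_append, links, ih, Multiset.cons_swap]

theorem pathEdges_cons_flat_append (c : α) (ps : List (EndedPath α)) (d : α) (l : List α) :
    pathEdges (c :: (flat ps ++ d :: l)) = links c ps d + edgeSum ps + pathEdges (d :: l) := by
  induction ps generalizing c with
  | nil => simp [flat, links]
  | cons p ps ih =>
    have h : c :: (flat (p :: ps) ++ d :: l) =
        c :: p.fst :: (p.mid ++ p.lst :: (flat ps ++ d :: l)) := by
      simp [flat, verts]
    have h' := pathEdges_append (p.fst :: p.mid) p.lst (flat ps ++ d :: l)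
    simp only [List.cons_append] at h'
    rw [h, pathEdges_cons_cons, h', ih, links, ← Multiset.cons_coe, edgeSum_cons]
    simp only [edges, verts, ← Multiset.singleton_add]
    abel

theorem cycleEdges_flat_cons (p : EndedPath α) (ps : List (EndedPath α)) :
    cycleEdges (flat (p :: ps)) = edgeSum (p ::ₘ (ps : Multiset _)) + links p.lst ps p.fst := by
  have h : cycleEdges (flat (p :: ps)) =
      pathEdges ((p.fst :: p.mid) ++ p.lst :: (flat ps ++ p.fst :: [])) := by
    simp [flat, verts, cycleEdges]
  rw [h, pathEdges_append, pathEdges_cons_flat_append, edgeSum_cons]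
  simp only [edges, verts, pathEdges_singleton, List.cons_append]
  abel

/-- Given a path from `h` to `t`, the linking edges of two concatenations of the paths `ps`, one
starting at `t` in the given order and one starting at `h` with all paths reversed, extend it at
both sides to a single path. -/
theorem exists_interleave (ps : List (EndedPath α)) {l : List α} {h t : α}
    (hl : ∀ c d, pathEdges (c :: (l ++ [d])) = s(c, h) ::ₘ s(t, d) ::ₘ pathEdges l) :
    ∃ z : List α, (z : Multiset α) = (l : Multiset α) + endSum (ps : Multiset _) ∧
      ∀ c d, pathEdges (c :: (z ++ [d])) =
        pathEdges l + links t ps d + links h (ps.map rev) c := by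
  induction ps generalizing l h t with
  | nil =>
    refine ⟨l, by simp, fun c d => ?_⟩
    rw [hl]
    simp only [links, List.map_nil, ← Multiset.singleton_add, Sym2.eq_swap (a := c)]
    abel
  | cons p ps ih =>
    have hrev : p.fst :: (l.reverse ++ [p.lst]) = (p.lst :: (l ++ [p.fst])).reverse := by simp
    have hl' : pathEdges (p.fst :: (l.reverse ++ [p.lst])) =
        s(p.lst, h) ::ₘ s(t, p.fst) ::ₘ pathEdges l := by
      rw [hrev, pathEdges_reverse, hl]
    obtain ⟨z, hz, hzl⟩ := ih (l := p.fst :: (l.reverse ++ [p.lst])) (h := p.fst) (t := p.lst)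
      fun c d => by
        have := pathEdges_append_pair (c :: p.fst :: l.reverse) p.lst d
        simp only [List.cons_append] at this
        simp only [List.cons_append, List.append_assoc, List.nil_append]
        rw [this, pathEdges_cons_cons, Multiset.cons_swap]
    refine ⟨z, ?_, fun c d => ?_⟩
    · rw [hz, ← Multiset.cons_coe p, endSum_cons]
      have : ((p.fst :: (l.reverse ++ [p.lst]) : List α) : Multiset α) = (l : Multiset α) + p.ends := by
        rw [hrev, Multiset.coe_reverse]
        simp only [ends, ← Multiset.cons_coe, ← Multiset.coe_add, Multiset.insert_eq_cons,
          ← Multiset.singleton_add]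
        abel
      rw [this, add_assoc]
    · rw [hzl, hl']
      simp only [links, List.map_cons, ← Multiset.singleton_add, rev, Sym2.eq_swap (a := h)]
      abel

end EndedPath

open EndedPath

theorem sdiff_val_add_val {α : Type*} [DecidableEq α] {s t : Finset α} (h : t ⊆ s) :
    (s \ t).val + t.val = s.val := by
  rw [Finset.sdiff_val]
  exact tsub_add_cancel_of_le (Finset.val_le_iff.2 h)

/-- A perfect matching of `U`, as a family of paths. -/
theorem exists_paths_of_matching {F : Finset (Sym2 V)} {U : Finset V} (hs : SimpleE F)
    (hd : ∀ v, degE F v = if v ∈ U then 1 else 0) :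
    ∃ P : Multiset (EndedPath V), edgeSum P = F.val ∧ vertSum P = U.val ∧ endSum P = U.val ∧
      ∀ p ∈ P, p.mid = [] := by
  induction F using Finset.induction_on generalizing U with
  | empty =>
    have : U = ∅ := by
      refine Finset.eq_empty_of_forall_notMem fun v hv => ?_
      have := hd v
      simp [degE, hv] at this
    exact ⟨0, by simp [this]⟩
  | insert e F he ih =>
    induction e with
    | h x y =>
    have hxy : x ≠ y := fun h => hs s(x, y) (by simp) (by simpa using h)
    have hdeg : ∀ v, degE (insert s(x, y) F) v = degE F v + if v = x ∨ v = y then 1 else 0 := by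
      intro v
      simp only [degE_eq_countP, Finset.insert_val_of_notMem he, Multiset.countP_cons, Sym2.mem_iff]
    have hx : x ∈ U := by
      by_contra h
      have := hd x
      simp [hdeg, h] at this
    have hy : y ∈ U := by
      by_contra h
      have := hd y
      simp [hdeg, h] at this
    obtain ⟨P, h1, h2, h3, h4⟩ := ih (U := (U.erase x).erase y)
      (fun e he => hs e (Finset.mem_insert_of_mem he)) (fun v => by
        have h := hd v
        rw [hdeg] at h
        simp only [Finset.mem_erase]
        by_cases hvx : v = x
        · subst hvx
          simpa [hx] using h
        by_cases hvy : v = y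
        · subst hvy
          simpa [hy] using h
        simpa [hvx, hvy] using h)
    have hU : U.val = x ::ₘ y ::ₘ ((U.erase x).erase y).val := by
      rw [Finset.erase_val, Multiset.cons_erase, Finset.erase_val, Multiset.cons_erase]
      · exact hx
      · exact Finset.mem_erase.2 ⟨hxy.symm, hy⟩
    refine ⟨⟨x, [], y⟩ ::ₘ P, ?_, ?_, ?_, ?_⟩
    · rw [edgeSum_cons, h1, Finset.insert_val_of_notMem he]
      simp [edges, verts]
    · rw [vertSum_cons, h2, hU]
      generalize ((U.erase x).erase y).val = m
      change (x ::ₘ y ::ₘ 0) + m = _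
      simp
    · rw [endSum_cons, h3, hU]
      generalize ((U.erase x).erase y).val = m
      change (x ::ₘ y ::ₘ 0) + m = _
      simp
    · intro p hp
      rcases Multiset.mem_cons.1 hp with rfl | hp
      · rfl
      · exact h4 p hp

/-- One edge of each cycle of a disjoint union of cycles can be transferred to a family of paths
having all vertices of these cycles as endpoints, such that a family of paths arises again. -/
theorem exists_transfer {F : Finset (Sym2 V)} {U : Finset V} {P : Multiset (EndedPath V)}
    (hs : SimpleE F) (hd : ∀ v, degE F v = if v ∈ U then 2 else 0) (hP : (endSum P).Nodup)
    (hU : ∀ v ∈ U, v ∈ endSum P) :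
    ∃ (G : Multiset (Sym2 V)) (Q L : Multiset (EndedPath V)),
      edgeSum Q = edgeSum P + G ∧ vertSum Q = vertSum P ∧ F.val = edgeSum L + G ∧
      vertSum L = U.val ∧ endSum Q + endSum L = endSum P := by
  induction F using Finset.strongInduction generalizing U P with
  | H F ih =>
  rcases F.eq_empty_or_nonempty with rfl | hF
  · have : U = ∅ := by
      refine Finset.eq_empty_of_forall_notMem fun v hv => ?_
      have := hd v
      simp [degE, hv] at this
    exact ⟨0, P, 0, by simp [this]⟩
  obtain ⟨l, hl, h3, hlF⟩ := exists_cycleEdges_subset hs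
    (fun v => by rw [hd v]; split_ifs <;> simp) hF
  set C : Finset (Sym2 V) := ⟨cycleEdges l, nodup_cycleEdges hl h3⟩ with hC
  have hCF : C ⊆ F := fun e he => hlF e he
  have hCd : ∀ v, degE C v = if v ∈ l then 2 else 0 := degE_eq_of_val_eq hl h3 rfl
  have hlU : l.toFinset ⊆ U := fun v hv => by
    by_contra h
    have := degE_le_of_subset hCF v
    rw [hCd, hd, if_pos (List.mem_toFinset.1 hv), if_neg h] at this
    omega
  have hlval : l.toFinset.val = (l : Multiset V) := by
    rw [List.toFinset_val, hl.dedup]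
  obtain ⟨p, hpl, hpe, hpP⟩ := exists_joining_edge hP hl h3
    fun v hv => hU v (hlU (List.mem_toFinset.2 hv))
  have hfst : p.fst ∈ l := hpl.mem_iff.2 (by simp [verts])
  have hlst : p.lst ∈ l := hpl.mem_iff.2 (by simp [verts])
  obtain ⟨P', h1, h2, h3'⟩ := exists_join (hU _ (hlU (List.mem_toFinset.2 hfst)))
    (hU _ (hlU (List.mem_toFinset.2 hlst))) hpP
  obtain ⟨a, b, m, c, hlabc⟩ := exists_eq_of_three_le_length h3
  have hCne : C.Nonempty := by
    refine ⟨s(p.fst, p.lst), ?_⟩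
    rw [← Finset.mem_val]
    change _ ∈ cycleEdges l
    simp [hpe]
  obtain ⟨G, Q, L, g1, g2, g3, g4, g5⟩ := ih (F \ C) (Finset.sdiff_ssubset hCF hCne)
    (U := U \ l.toFinset) (P := P') (fun e he => hs e (Finset.mem_sdiff.1 he).1)
    (fun v => by
      rw [degE_sdiff hCF, hd, hCd]
      by_cases hvl : v ∈ l
      · simp [hvl, hlU (List.mem_toFinset.2 hvl)]
      · simp [hvl])
    (by
      rw [← h3'] at hP
      exact (Multiset.nodup_cons.1 (Multiset.nodup_cons.1 hP).2).2)
    (fun v hv => by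
      rw [Finset.mem_sdiff, List.mem_toFinset] at hv
      have := hU v hv.1
      rw [← h3', Multiset.mem_cons, Multiset.mem_cons] at this
      rcases this with rfl | rfl | h
      · exact absurd hfst hv.2
      · exact absurd hlst hv.2
      · exact h)
  refine ⟨s(p.fst, p.lst) ::ₘ G, Q, p ::ₘ L, ?_, ?_, ?_, ?_, ?_⟩
  · rw [g1, h1, Multiset.cons_add, Multiset.add_cons]
  · rw [g2, h2]
  · rw [← sdiff_val_add_val hCF, g3, edgeSum_cons]
    change _ + cycleEdges l = _
    rw [hpe]
    simp only [← Multiset.singleton_add]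
    abel
  · rw [vertSum_cons, g4, ← sdiff_val_add_val hlU, hlval, add_comm]
    congr 1
    exact (Multiset.coe_eq_coe.2 hpl).symm
  · rw [endSum_cons, ← h3', ← g5]
    simp only [ends, Multiset.insert_eq_cons, ← Multiset.singleton_add]
    abel

theorem Finset.val_eq_of_forall_mem_iff {α : Type*} {s : Finset α} {m : Multiset α}
    (hm : m.Nodup) (h : ∀ a, a ∈ s ↔ a ∈ m) : s.val = m :=
  (Multiset.Nodup.ext s.nodup hm).2 h

/-- The required conclusion, from cyclic lists of vertices for the four tours and for the cycle
formed by the linking edges. -/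
theorem exists_of_cycleEdges (ℓ : Sym2 V → ℝ) (hn : 3 < Fintype.card V) {S T : Finset (Sym2 V)}
    {v2 v3 q : V} {s₁ s₂ g₁ g₂ a₁ a₂ b₁ b₂ : Multiset (Sym2 V)} {l₁ l₂ m₁ m₂ c : List V}
    (hS₁ : S.val = s₁ + g₁) (hS₂ : S.val = s₂ + g₂)
    (hl₁ : cycleEdges l₁ = s₁ + a₁) (hl₂ : cycleEdges l₂ = s₂ + a₂)
    (hm₁ : cycleEdges m₁ = T.val + g₁ + b₁) (hm₂ : cycleEdges m₂ = T.val + g₂ + b₂)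
    (hc : cycleEdges c = a₁ + a₂ + b₁ + b₂)
    (hl₁V : (l₁ : Multiset V) = Finset.univ.val) (hl₂V : (l₂ : Multiset V) = Finset.univ.val)
    (hm₁V : (m₁ : Multiset V) = Finset.univ.val) (hm₂V : (m₂ : Multiset V) = Finset.univ.val)
    (hcV : v3 ::ₘ (c : Multiset V) = Finset.univ.val)
    (ha₁ : a₁ ≠ 0) (ha₂ : a₂ ≠ 0) (hb₁ : b₁ ≠ 0) (hb₂ : b₂ ≠ 0)
    (hs₁ : ∀ v, ∃ e ∈ s₁, v ∈ e) (hs₂ : ∀ v, ∃ e ∈ s₂, v ∈ e) (hT : ∀ v, ∃ e ∈ T, v ∈ e)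
    (hq : s(q, v2) ∈ a₁) :
    ∃ S1 S2 T1 T2 : Finset (Sym2 V),
      IsPathCoverE S1 ∧ IsPathCoverE S2 ∧ IsPathCoverE T1 ∧ IsPathCoverE T2 ∧
      (S1 ∪ T1 = S ∪ T) ∧ (S1 ∩ T1 = S ∩ T) ∧
      (S2 ∪ T2 = S ∪ T) ∧ (S2 ∩ T2 = S ∩ T) ∧
      ∃ A1 A2 B1 B2 : Finset (Sym2 V),
        Disjoint A1 A2 ∧ Disjoint A1 B1 ∧ Disjoint A1 B2 ∧
        Disjoint A2 B1 ∧ Disjoint A2 B2 ∧ Disjoint B1 B2 ∧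
        Disjoint S1 A1 ∧ Disjoint S2 A2 ∧ Disjoint T1 B1 ∧ Disjoint T2 B2 ∧
        IsTourE (S1 ∪ A1) ∧ IsTourE (S2 ∪ A2) ∧
        IsTourE (T1 ∪ B1) ∧ IsTourE (T2 ∪ B2) ∧
        (IsCycleE (A1 ∪ A2 ∪ B1 ∪ B2) ∨
          (∃ C1 C2 : Finset (Sym2 V), IsCycleE C1 ∧ IsCycleE C2 ∧
            Disjoint (VsetE C1) (VsetE C2) ∧ A1 ∪ A2 ∪ B1 ∪ B2 = C1 ∪ C2)) ∧
        VsetE (A1 ∪ A2 ∪ B1 ∪ B2) = Set.univ \ {v3} ∧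
        (∃ D : Finset (Sym2 V), IsCycleE D ∧ VsetE D = Set.univ \ {v3} ∧
          s(q, v2) ∈ D ∧ lenE ℓ (A1 ∪ A2 ∪ B1 ∪ B2) ≤ lenE ℓ D) := by
  have hnd : ∀ {l : List V}, (l : Multiset V) = Finset.univ.val → l.Nodup ∧ 3 ≤ l.length := by
    intro l hl
    refine ⟨?_, ?_⟩
    · rw [← Multiset.coe_nodup, hl]
      exact Finset.univ.nodup
    · have := congrArg Multiset.card hl
      rw [Multiset.coe_card, Finset.card_val, Finset.card_univ] at this
      omega
  have hcn : (v3 :: c).Nodup ∧ 3 ≤ c.length := by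
    refine ⟨?_, ?_⟩
    · rw [← Multiset.coe_nodup, ← Multiset.cons_coe, hcV]
      exact Finset.univ.nodup
    · have := congrArg Multiset.card hcV
      rw [Multiset.card_cons, Multiset.coe_card, Finset.card_val, Finset.card_univ] at this
      omega
  have key : ∀ {l : List V} {F A : Finset (Sym2 V)}, (l : Multiset V) = Finset.univ.val →
      cycleEdges l = F.val + A.val → A.val ≠ 0 → (∀ v, ∃ e ∈ F, v ∈ e) →
      IsPathCoverE F ∧ Disjoint F A ∧ IsTourE (F ∪ A) := by
    intro l F A hl h hA hF
    obtain ⟨h1, h2⟩ := hnd hl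
    have h3 := nodup_cycleEdges h1 h2
    rw [h, Multiset.nodup_add] at h3
    refine ⟨isPathCoverE_of_val_add_eq_cycleEdges h1 h2 h.symm hA hF,
      Finset.disjoint_left.2 fun e he he' => Multiset.disjoint_left.1 h3.2.2 he he',
      isCycleE_iff.2 ⟨l, h1, h2, ?_⟩, Set.eq_univ_of_forall fun v => ?_⟩
    · refine Finset.val_eq_of_forall_mem_iff (nodup_cycleEdges h1 h2) fun e => ?_
      rw [h, Finset.mem_union, Multiset.mem_add, Finset.mem_val, Finset.mem_val]
    · obtain ⟨e, he, hv⟩ := hF v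
      exact ⟨e, Finset.mem_union_left _ he, hv⟩
  have nS₁ := S.nodup
  have nS₂ := S.nodup
  rw [hS₁, Multiset.nodup_add] at nS₁
  rw [hS₂, Multiset.nodup_add] at nS₂
  have nm₁ := nodup_cycleEdges (hnd hm₁V).1 (hnd hm₁V).2
  have nm₂ := nodup_cycleEdges (hnd hm₂V).1 (hnd hm₂V).2
  rw [hm₁, Multiset.nodup_add] at nm₁
  rw [hm₂, Multiset.nodup_add] at nm₂
  have nc := nodup_cycleEdges (List.nodup_cons.1 hcn.1).2 hcn.2
  have nc' := nc
  rw [hc, Multiset.nodup_add, Multiset.nodup_add, Multiset.nodup_add] at nc'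
  obtain ⟨⟨⟨na₁, na₂, da⟩, nb₁, dab₁⟩, nb₂, dab₂⟩ := nc'
  rw [Multiset.disjoint_left] at da dab₁ dab₂
  simp only [Multiset.mem_add] at dab₁ dab₂
  have hCC : (⟨a₁, na₁⟩ ∪ ⟨a₂, na₂⟩ ∪ ⟨b₁, nb₁⟩ ∪ ⟨b₂, nb₂⟩ : Finset (Sym2 V)).val =
      cycleEdges c := by
    refine Finset.val_eq_of_forall_mem_iff nc fun e => ?_
    rw [hc]
    simp only [Finset.mem_union, Multiset.mem_add, Finset.mem_mk]
  have hcyc : IsCycleE (⟨a₁, na₁⟩ ∪ ⟨a₂, na₂⟩ ∪ ⟨b₁, nb₁⟩ ∪ ⟨b₂, nb₂⟩ : Finset (Sym2 V)) :=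
    isCycleE_iff.2 ⟨c, (List.nodup_cons.1 hcn.1).2, hcn.2, hCC⟩
  have hVs : VsetE (⟨a₁, na₁⟩ ∪ ⟨a₂, na₂⟩ ∪ ⟨b₁, nb₁⟩ ∪ ⟨b₂, nb₂⟩ : Finset (Sym2 V)) =
      Set.univ \ {v3} := by
    have hmem : ∀ v, v ∈ c ↔ v ≠ v3 := by
      intro v
      have : v ∈ v3 ::ₘ (c : Multiset V) := by
        rw [hcV]
        exact Finset.mem_univ v
      refine ⟨?_, fun h => (Multiset.mem_cons.1 this).resolve_left h⟩
      rintro hv rfl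
      exact (List.nodup_cons.1 hcn.1).1 hv
    ext v
    simp only [VsetE, Set.mem_ofPred_eq, Set.mem_sdiff, Set.mem_univ, true_and,
      Set.mem_singleton_iff, ← hmem, ← Finset.mem_val, hCC]
    exact ⟨fun ⟨e, he, hv⟩ => mem_of_mem_cycleEdges he hv, exists_mem_cycleEdges⟩
  obtain ⟨x1, x2, x3⟩ := key (F := ⟨s₁, nS₁.1⟩) (A := ⟨a₁, na₁⟩) hl₁V hl₁ ha₁ hs₁
  obtain ⟨y1, y2, y3⟩ := key (F := ⟨s₂, nS₂.1⟩) (A := ⟨a₂, na₂⟩) hl₂V hl₂ ha₂ hs₂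
  obtain ⟨z1, z2, z3⟩ := key (F := ⟨_, nm₁.1⟩) (A := ⟨b₁, nb₁⟩) hm₁V hm₁ hb₁
    fun v => (hT v).imp fun e he => ⟨Multiset.mem_add.2 (Or.inl he.1), he.2⟩
  obtain ⟨w1, w2, w3⟩ := key (F := ⟨_, nm₂.1⟩) (A := ⟨b₂, nb₂⟩) hm₂V hm₂ hb₂
    fun v => (hT v).imp fun e he => ⟨Multiset.mem_add.2 (Or.inl he.1), he.2⟩
  have hSm₁ : ∀ e, e ∈ S ↔ e ∈ s₁ ∨ e ∈ g₁ := fun e => by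
    rw [← Finset.mem_val, hS₁, Multiset.mem_add]
  have hSm₂ : ∀ e, e ∈ S ↔ e ∈ s₂ ∨ e ∈ g₂ := fun e => by
    rw [← Finset.mem_val, hS₂, Multiset.mem_add]
  have dS₁ : ∀ e, e ∈ s₁ → e ∉ g₁ := fun e h => Multiset.disjoint_left.1 nS₁.2.2 h
  have dS₂ : ∀ e, e ∈ s₂ → e ∉ g₂ := fun e h => Multiset.disjoint_left.1 nS₂.2.2 h
  have dT₁ : ∀ e, e ∈ T.val → e ∉ g₁ :=
    fun e h => Multiset.disjoint_left.1 (Multiset.nodup_add.1 nm₁.1).2.2 h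
  have dT₂ : ∀ e, e ∈ T.val → e ∉ g₂ :=
    fun e h => Multiset.disjoint_left.1 (Multiset.nodup_add.1 nm₂.1).2.2 h
  refine ⟨_, _, _, _, x1, y1, z1, w1, ?_, ?_, ?_, ?_, _, _, _, _, ?_, ?_, ?_, ?_, ?_, ?_,
    x2, y2, z2, w2, x3, y3, z3, w3, Or.inl hcyc, hVs, _, hcyc, hVs, ?_, le_rfl⟩
  · ext e
    simp only [Finset.mem_union, Finset.mem_mk, Multiset.mem_add, Finset.mem_val, hSm₁]
    tauto
  · ext e
    have h1 := dS₁ e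
    have h2 := dT₁ e
    simp only [Finset.mem_inter, Finset.mem_mk, Multiset.mem_add, Finset.mem_val, hSm₁] at h2 ⊢
    tauto
  · ext e
    simp only [Finset.mem_union, Finset.mem_mk, Multiset.mem_add, Finset.mem_val, hSm₂]
    tauto
  · ext e
    have h1 := dS₂ e
    have h2 := dT₂ e
    simp only [Finset.mem_inter, Finset.mem_mk, Multiset.mem_add, Finset.mem_val, hSm₂] at h2 ⊢
    tauto
  · exact Finset.disjoint_left.2 fun e h h' => da h h'
  · exact Finset.disjoint_left.2 fun e h h' => dab₁ (Or.inl h) h'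
  · exact Finset.disjoint_left.2 fun e h h' => dab₂ (Or.inl (Or.inl h)) h'
  · exact Finset.disjoint_left.2 fun e h h' => dab₁ (Or.inr h) h'
  · exact Finset.disjoint_left.2 fun e h h' => dab₂ (Or.inl (Or.inr h)) h'
  · exact Finset.disjoint_left.2 fun e h h' => dab₂ (Or.inr h) h'
  · simp only [Finset.mem_union, Finset.mem_mk, hq, true_or]

theorem EndedPath.exists_interleave_singleton {α : Type*} (ps : List (EndedPath α)) (x : α) :
    ∃ z : List α, (z : Multiset α) = x ::ₘ endSum (ps : Multiset _) ∧
      ∀ c d, pathEdges (c :: (z ++ [d])) = links x ps d + links x (ps.map rev) c := by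
  obtain ⟨z, hz, h⟩ := exists_interleave ps (l := [x]) (h := x) (t := x) (fun c d => by simp)
  exact ⟨z, by simpa using hz, by simpa using h⟩

theorem exists_cycle_of_eq {α : Type*} (ls qs : List (EndedPath α)) (v1 v2 v4 q q' x : α) :
    ∃ c : List α,
      (c : Multiset α) = {v1, v2, v4, q, q', x} + endSum (ls : Multiset _) + endSum (qs : Multiset _) ∧
      cycleEdges c = (s(v2, q) ::ₘ links q' ls v1) + (s(v1, q) ::ₘ links q' (ls.map rev) v4) +
        links v4 qs x + links v2 (qs.map rev) x := by
  obtain ⟨z, hz, hz'⟩ := exists_interleave_singleton ls q'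
  have h1 : ∀ c d, pathEdges (c :: (([v2, q, v1] ++ z.reverse ++ [v4]) ++ [d])) =
      s(c, v2) ::ₘ s(v4, d) ::ₘ pathEdges ([v2, q, v1] ++ z.reverse ++ [v4]) := by
    intro c d
    have := pathEdges_append_pair ([c, v2, q, v1] ++ z.reverse) v4 d
    simp only [List.cons_append, List.nil_append, List.append_assoc] at this ⊢
    rw [this, pathEdges_cons_cons, Multiset.cons_swap]
  have h2 : pathEdges ([v2, q, v1] ++ z.reverse ++ [v4]) =
      s(v2, q) ::ₘ s(q, v1) ::ₘ (links q' ls v1 + links q' (ls.map rev) v4) := by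
    have : v1 :: (z.reverse ++ [v4]) = (v4 :: (z ++ [v1])).reverse := by simp
    simp only [List.cons_append, List.nil_append, pathEdges_cons_cons]
    rw [this, pathEdges_reverse, hz']
  obtain ⟨w, hw, hw'⟩ := exists_interleave qs h1
  refine ⟨x :: w, ?_, ?_⟩
  · rw [← Multiset.cons_coe, hw]
    simp only [← Multiset.coe_add, Multiset.coe_reverse, hz, ← Multiset.cons_coe,
      Multiset.insert_eq_cons, ← Multiset.singleton_add, Multiset.coe_nil]
    abel
  · change pathEdges (x :: (w ++ [x])) = _
    rw [hw', h2, Sym2.eq_swap (a := q)]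
    simp only [← Multiset.singleton_add]
    abel

theorem exists_path_of_ne {α : Type*} (ls qs : List (EndedPath α)) (v1 v2 v4 v5 q q' : α) :
    ∃ z : List α,
      (z : Multiset α) = {v2, v4, v5, q, q'} + endSum (ls : Multiset _) + endSum (qs : Multiset _) ∧
      ∀ x, pathEdges (x :: (z ++ [v1])) =
        (s(v2, q) ::ₘ links q' ls v1) + (s(v4, q) ::ₘ links q' (ls.map rev) v5) +
          links v4 qs v5 + links v2 (qs.map rev) x := by
  obtain ⟨z, hz, hz'⟩ := exists_interleave_singleton ls q'
  obtain ⟨w, hw, hw'⟩ := exists_interleave qs (l := [v2, q, v4]) (h := v2) (t := v4)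
    fun c d => by
      simp only [List.cons_append, List.nil_append, pathEdges_cons_cons, pathEdges_singleton,
        ← Multiset.singleton_add]
      abel
  refine ⟨w ++ v5 :: z, ?_, fun x => ?_⟩
  · rw [← Multiset.coe_add, hw, ← Multiset.cons_coe v5, hz]
    simp only [← Multiset.cons_coe, Multiset.insert_eq_cons, ← Multiset.singleton_add,
      Multiset.coe_nil]
    abel
  · have := pathEdges_append (x :: w) v5 (z ++ [v1])
    simp only [List.cons_append] at this
    rw [List.append_assoc, List.cons_append, this, hw', hz', Sym2.eq_swap (a := v4)]
    simp only [pathEdges_cons_cons, pathEdges_singleton, ← Multiset.singleton_add]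
    abel

/-- The required conclusion, from families of paths that are closed up to tours by concatenating
them cyclically. -/
theorem exists_of_paths (ℓ : Sym2 V → ℝ) (hn : 3 < Fintype.card V) {S T : Finset (Sym2 V)}
    {v3 : V} {g₁ g₂ : Multiset (Sym2 V)} {p₁ p₂ p r₁ r₂ : EndedPath V}
    {ls rs₁ rs₂ : List (EndedPath V)} {c : List V}
    (hS₁ : S.val = p₁.edges + p.edges + edgeSum (ls : Multiset _) + g₁)
    (hS₂ : S.val = p₂.edges + p.edges + edgeSum (ls : Multiset _) + g₂)
    (hT₁ : T.val + g₁ = r₁.edges + edgeSum (rs₁ : Multiset _))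
    (hT₂ : T.val + g₂ = r₂.edges + edgeSum (rs₂ : Multiset _))
    (hp₁ : (p₁.verts : Multiset V) + (p.verts : Multiset V) + vertSum (ls : Multiset _) = Finset.univ.val)
    (hp₂ : (p₂.verts : Multiset V) + (p.verts : Multiset V) + vertSum (ls : Multiset _) = Finset.univ.val)
    (hr₁ : (r₁.verts : Multiset V) + vertSum (rs₁ : Multiset _) = Finset.univ.val)
    (hr₂ : (r₂.verts : Multiset V) + vertSum (rs₂ : Multiset _) = Finset.univ.val)
    (hc : cycleEdges c = (s(p₁.lst, p.fst) ::ₘ links p.lst ls p₁.fst) +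
      (s(p₂.lst, p.fst) ::ₘ links p.lst (ls.map rev) p₂.fst) + links r₁.lst rs₁ r₁.fst +
      links r₂.lst rs₂ r₂.fst)
    (hcV : v3 ::ₘ (c : Multiset V) = Finset.univ.val) (hT : ∀ v, ∃ e ∈ T, v ∈ e) :
    ∃ S1 S2 T1 T2 : Finset (Sym2 V),
      IsPathCoverE S1 ∧ IsPathCoverE S2 ∧ IsPathCoverE T1 ∧ IsPathCoverE T2 ∧
      (S1 ∪ T1 = S ∪ T) ∧ (S1 ∩ T1 = S ∩ T) ∧
      (S2 ∪ T2 = S ∪ T) ∧ (S2 ∩ T2 = S ∩ T) ∧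
      ∃ A1 A2 B1 B2 : Finset (Sym2 V),
        Disjoint A1 A2 ∧ Disjoint A1 B1 ∧ Disjoint A1 B2 ∧
        Disjoint A2 B1 ∧ Disjoint A2 B2 ∧ Disjoint B1 B2 ∧
        Disjoint S1 A1 ∧ Disjoint S2 A2 ∧ Disjoint T1 B1 ∧ Disjoint T2 B2 ∧
        IsTourE (S1 ∪ A1) ∧ IsTourE (S2 ∪ A2) ∧
        IsTourE (T1 ∪ B1) ∧ IsTourE (T2 ∪ B2) ∧
        (IsCycleE (A1 ∪ A2 ∪ B1 ∪ B2) ∨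
          (∃ C1 C2 : Finset (Sym2 V), IsCycleE C1 ∧ IsCycleE C2 ∧
            Disjoint (VsetE C1) (VsetE C2) ∧ A1 ∪ A2 ∪ B1 ∪ B2 = C1 ∪ C2)) ∧
        VsetE (A1 ∪ A2 ∪ B1 ∪ B2) = Set.univ \ {v3} ∧
        (∃ D : Finset (Sym2 V), IsCycleE D ∧ VsetE D = Set.univ \ {v3} ∧
          s(p.fst, p₁.lst) ∈ D ∧ lenE ℓ (A1 ∪ A2 ∪ B1 ∪ B2) ≤ lenE ℓ D) := by
  have span : ∀ (r : EndedPath V),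
      (r.verts : Multiset V) + (p.verts : Multiset V) + vertSum (ls : Multiset _) = Finset.univ.val → ∀ v, ∃ e ∈ r.edges + p.edges + edgeSum (ls : Multiset _), v ∈ e := by
    intro r hr v
    have : r.edges + p.edges + edgeSum (ls : Multiset _) =
        edgeSum (r ::ₘ p ::ₘ (ls : Multiset _)) := by
      rw [edgeSum_cons, edgeSum_cons, add_assoc]
    rw [this]
    refine exists_mem_edgeSum ?_
    rw [vertSum_cons, vertSum_cons, ← add_assoc, hr]
    exact Finset.mem_univ v
  refine exists_of_cycleEdges ℓ hn hS₁ hS₂ (l₁ := flat (p₁ :: p :: ls))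
    (l₂ := flat (p₂ :: p :: ls.map rev)) (m₁ := flat (r₁ :: rs₁)) (m₂ := flat (r₂ :: rs₂))
    ?_ ?_ ?_ ?_ hc ?_ ?_ ?_ ?_ hcV ?_ ?_ (links_ne_zero _ _ _) (links_ne_zero _ _ _)
    (span _ hp₁) (span _ hp₂) hT ?_
  · rw [cycleEdges_flat_cons, ← Multiset.cons_coe, edgeSum_cons, edgeSum_cons, ← add_assoc]
    rfl
  · rw [cycleEdges_flat_cons, ← Multiset.cons_coe, edgeSum_cons, edgeSum_cons, ← add_assoc,
      ← Multiset.map_coe, edgeSum_map_rev]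
    rfl
  · rw [cycleEdges_flat_cons, edgeSum_cons, hT₁]
  · rw [cycleEdges_flat_cons, edgeSum_cons, hT₂]
  · rw [coe_flat, ← hp₁, ← Multiset.cons_coe, vertSum_cons, ← Multiset.cons_coe, vertSum_cons,
      add_assoc]
  · rw [coe_flat, ← hp₂, ← Multiset.cons_coe, vertSum_cons, ← Multiset.cons_coe, vertSum_cons,
      ← Multiset.map_coe, vertSum_map_rev, add_assoc]
  · rw [coe_flat, ← hr₁, ← Multiset.cons_coe, vertSum_cons]
  · rw [coe_flat, ← hr₂, ← Multiset.cons_coe, vertSum_cons]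
  · exact Multiset.cons_ne_zero
  · exact Multiset.cons_ne_zero
  · rw [Sym2.eq_swap]
    exact Multiset.mem_cons_self _ _

namespace EndedPath

/-- The extension of a path by three vertices after its last vertex. -/
def extend {α : Type*} (p : EndedPath α) (x y z : α) : EndedPath α :=
  ⟨p.fst, p.mid ++ [p.lst, x, y], z⟩

theorem edges_extend {α : Type*} (p : EndedPath α) (x y z : α) :
    (p.extend x y z).edges = p.edges + {s(p.lst, x), s(x, y), s(y, z)} := by
  have := pathEdges_append (p.fst :: p.mid) p.lst [x, y, z]
  simp only [List.cons_append] at this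
  simp only [edges, extend, verts, List.append_assoc, List.cons_append, List.nil_append, this]
  simp [Multiset.insert_eq_cons]

theorem coe_verts_extend {α : Type*} (p : EndedPath α) (x y z : α) :
    ((p.extend x y z).verts : Multiset α) = (p.verts : Multiset α) + {x, y, z} := by
  have : (p.extend x y z).verts = p.verts ++ [x, y, z] := by simp [verts, extend]
  rw [this]
  rfl

end EndedPath

/-- A cycle with three given consecutive edges either has length four or is completed by a path. -/
theorem exists_of_mem_cycleEdges_of_mem_of_mem {α : Type*} {l : List α} {v1 v2 v3 v4 : α}
    (hl : l.Nodup) (h3 : 3 ≤ l.length) (h14 : v1 ≠ v4) (h24 : v2 ≠ v4) (h13 : v1 ≠ v3)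
    (h12 : s(v1, v2) ∈ cycleEdges l) (h23 : s(v2, v3) ∈ cycleEdges l)
    (h34 : s(v3, v4) ∈ cycleEdges l) :
    ((l : Multiset α) = {v1, v2, v3, v4} ∧
      cycleEdges l = {s(v1, v2), s(v2, v3), s(v3, v4), s(v4, v1)}) ∨
    ∃ p : EndedPath α, p.lst = v1 ∧ (l : Multiset α) = (p.verts : Multiset α) + {v2, v3, v4} ∧
      cycleEdges l = p.edges + {s(v1, v2), s(v2, v3), s(v3, v4), s(v4, p.fst)} := by
  rw [Sym2.eq_swap] at h23
  obtain ⟨m, hp, hc⟩ := exists_path_of_mem_cycleEdges hl h3 h23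
  have hn := hp.nodup hl
  have hr : (v3 :: (m ++ [v2])).reverse = v2 :: (m.reverse ++ [v3]) := by simp
  have hn' := List.nodup_reverse.2 hn
  have g34 : s(v3, v4) ∈ pathEdges (v3 :: (m ++ [v2])) := by
    rw [hc] at h34
    refine (Multiset.mem_cons.1 h34).resolve_left fun h => h24 ?_
    exact (Sym2.congr_right.1 h).symm
  have g12 : s(v2, v1) ∈ pathEdges (v2 :: (m.reverse ++ [v3])) := by
    rw [hc] at h12
    rw [← hr, pathEdges_reverse, Sym2.eq_swap]
    refine (Multiset.mem_cons.1 h12).resolve_left fun h => h13 ?_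
    rw [Sym2.eq_swap, Sym2.eq_swap (a := v3)] at h
    exact Sym2.congr_right.1 h
  have hh : m.head? = some v4 := by
    cases m with
    | nil =>
      simp at g34
      grind
    | cons w m =>
      have := eq_of_mem_pathEdges_of_mem_head hn g34 (by simp)
      rw [Sym2.congr_right] at this
      simp [this]
  have hh' : m.reverse.head? = some v1 := by
    rw [hr] at hn'
    generalize m.reverse = m' at hn' g12
    cases m' with
    | nil =>
      simp at g12
      grind
    | cons w m' =>
      have := eq_of_mem_pathEdges_of_mem_head hn' g12 (by simp)
      rw [Sym2.congr_right] at this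
      simp [this]
  cases m with
  | nil => simp at hh
  | cons w m =>
  obtain rfl : w = v4 := by simpa using hh
  rcases m.eq_nil_or_concat with rfl | ⟨m, u, rfl⟩
  · exact absurd (by simpa using hh') h14.symm
  obtain rfl : u = v1 := by simpa using hh'
  have hpv := Multiset.coe_eq_coe.2 hp
  cases m with
  | nil =>
    left
    rw [hpv, hc]
    simp only [List.nil_append, List.cons_append, pathEdges_cons_cons, pathEdges_singleton,
      ← Multiset.cons_coe, Multiset.insert_eq_cons, ← Multiset.singleton_add, Multiset.coe_nil,
      Sym2.eq_swap (a := v3) (b := v2), List.concat_eq_append]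
    constructor <;> abel
  | cons x m =>
    right
    refine ⟨⟨x, m, u⟩, rfl, ?_, ?_⟩
    · rw [hpv]
      simp only [EndedPath.verts, List.concat_eq_append, List.cons_append, ← Multiset.coe_add,
        ← Multiset.cons_coe, Multiset.insert_eq_cons, ← Multiset.singleton_add, Multiset.coe_nil]
      abel
    · have := pathEdges_append_pair (v3 :: w :: x :: m) u v2
      simp only [List.cons_append] at this
      simp only [hc, List.concat_eq_append, List.append_assoc, List.cons_append, List.nil_append,
        this]
      simp only [EndedPath.edges, EndedPath.verts, pathEdges_cons_cons, Multiset.insert_eq_cons,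
        ← Multiset.singleton_add, Sym2.eq_swap (a := v3) (b := v2)]
      abel

/-- A path cover in which `v3` is the only vertex that is not an endpoint consists of single edges
and the path through `v2`, `v3`, `v4`. -/
theorem exists_paths_of_isPathCoverE {T : Finset (Sym2 V)} {v2 v3 v4 : V} (hT : IsPathCoverE T)
    (h23 : v2 ≠ v3) (h24 : v2 ≠ v4) (h34 : v3 ≠ v4) (h1 : s(v2, v3) ∈ T) (h2 : s(v3, v4) ∈ T)
    (hV : V1E T = Set.univ \ {v3}) :
    ∃ P : Multiset (EndedPath V), T.val = edgeSum P + {s(v2, v3), s(v3, v4)} ∧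
      Finset.univ.val = vertSum P + {v2, v3, v4} ∧ endSum P = vertSum P ∧
      ∀ p ∈ P, p.mid = [] := by
  set X : Finset (Sym2 V) := {s(v2, v3), s(v3, v4)} with hX
  have hne : s(v2, v3) ≠ s(v3, v4) := by
    rw [Sym2.eq_swap, Ne, Sym2.congr_right]
    exact h24
  have hXv : X.val = {s(v2, v3), s(v3, v4)} := by
    rw [hX, Finset.insert_val_of_notMem (by simpa using hne)]
    rfl
  have hXT : X ⊆ T := by
    intro e he
    rcases Finset.mem_insert.1 he with rfl | he
    · exact h1
    · rwa [Finset.mem_singleton.1 he]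
  have hXd : ∀ v, degE X v = (if v = v2 ∨ v = v3 then 1 else 0) +
      if v = v3 ∨ v = v4 then 1 else 0 := by
    intro v
    simp only [degE_eq_countP, hXv, Multiset.insert_eq_cons, Multiset.countP_cons,
      ← Multiset.cons_zero, Multiset.countP_zero, Sym2.mem_iff, zero_add]
    rw [add_comm]
  set U : Finset V := Finset.univ \ {v2, v3, v4} with hU
  have hUv : Finset.univ.val = U.val + {v2, v3, v4} := by
    rw [← sdiff_val_add_val (Finset.subset_univ ({v2, v3, v4} : Finset V))]
    congr 1
    rw [Finset.insert_val_of_notMem (by simp [h23, h24]),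
      Finset.insert_val_of_notMem (by simp [h34])]
    rfl
  obtain ⟨P, p1, p2, p3, p4⟩ := exists_paths_of_matching (F := T \ X) (U := U)
    (fun e he => hT.1.1 e (Finset.mem_sdiff.1 he).1) (fun v => by
      rw [degE_sdiff hXT, hXd]
      by_cases hv : v = v3
      · subst hv
        have := hT.1.2 v
        simp only [hU, Finset.mem_sdiff, Finset.mem_insert, Finset.mem_singleton, true_or, or_true,
          not_true, and_false, if_false, if_true]
        omega
      · have : v ∈ V1E T := by rw [hV]; exact ⟨trivial, hv⟩
        change degE T v = 1 at this
        rw [this]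
        by_cases hv2 : v = v2
        · simp [hU, hv2]
        by_cases hv4 : v = v4
        · simp [hU, hv4]
        simp [hU, hv, hv2, hv4])
  refine ⟨P, ?_, ?_, p3.trans p2.symm, p4⟩
  · rw [← sdiff_val_add_val hXT, p1, hXv]
  · rw [hUv, p2]

/-- Removing two different cycles from a `2`-factor leaves a `2`-factor on the other vertices. -/
theorem exists_val_eq_add_of_cycleEdges {S C C' : Finset (Sym2 V)} {l l' : List V}
    (hS : IsKFactor 2 S) (hl : l.Nodup) (h3 : 3 ≤ l.length) (hC : C.val = cycleEdges l)
    (hl' : l'.Nodup) (h3' : 3 ≤ l'.length) (hC' : C'.val = cycleEdges l') (hCS : C ⊆ S)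
    (hCS' : C' ⊆ S) (hne : C' ≠ C) :
    ∃ (F : Finset (Sym2 V)) (U : Finset V), SimpleE F ∧
      (∀ v, degE F v = if v ∈ U then 2 else 0) ∧
      S.val = cycleEdges l + cycleEdges l' + F.val ∧
      Finset.univ.val = (l : Multiset V) + (l' : Multiset V) + U.val := by
  have hd : ∀ v, degE S v ≤ 2 := fun v => (hS.2 v).le
  have hdisj : ∀ v ∈ l, v ∉ l' := fun v hv hv' =>
    hne ((subset_of_isCycleE hd hCS' hCS hC' hl h3 hC hv' hv).antisymm
      (subset_of_isCycleE hd hCS hCS' hC hl' h3' hC' hv hv'))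
  have hCC : C' ⊆ S \ C := by
    refine fun e he => Finset.mem_sdiff.2 ⟨hCS' he, fun he' => ?_⟩
    induction e with
    | h x y =>
    rw [← Finset.mem_val, hC] at he'
    rw [← Finset.mem_val, hC'] at he
    exact hdisj x (mem_of_mem_cycleEdges he' (by simp)) (mem_of_mem_cycleEdges he (by simp))
  have hll : l'.toFinset ⊆ Finset.univ \ l.toFinset := by
    intro v hv
    rw [List.mem_toFinset] at hv
    exact Finset.mem_sdiff.2 ⟨Finset.mem_univ v, fun h => hdisj v (List.mem_toFinset.1 h) hv⟩
  refine ⟨(S \ C) \ C', (Finset.univ \ l.toFinset) \ l'.toFinset, fun e he =>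
    hS.1 e (Finset.mem_sdiff.1 (Finset.mem_sdiff.1 he).1).1, fun v => ?_, ?_, ?_⟩
  · rw [degE_sdiff hCC, degE_sdiff hCS, hS.2, degE_eq_of_val_eq hl h3 hC,
      degE_eq_of_val_eq hl' h3' hC']
    have := hdisj v
    by_cases hv : v ∈ l
    · simp [hv]
    · by_cases hv' : v ∈ l' <;> simp [hv, hv']
  · rw [← sdiff_val_add_val hCS, ← sdiff_val_add_val hCC, hC, hC']
    abel
  · rw [← sdiff_val_add_val (Finset.subset_univ l.toFinset), ← sdiff_val_add_val hll,
      List.toFinset_val, hl'.dedup, List.toFinset_val, hl.dedup]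
    abel

theorem stmt14 (ℓ : Sym2 V → ℝ) (hℓ : ∀ e : Sym2 V, 0 ≤ ℓ e)
    (hn : 17 ≤ Fintype.card V)
    (S Cstar Cstar2 T' : Finset (Sym2 V)) (v1 v2 v3 v4 : V)
    (f : Sym2 V) (q : V)
    (hS : IsKFactor 2 S) (hSnot : ¬ IsTourE S)
    (hdist : v1 ≠ v2 ∧ v1 ≠ v3 ∧ v1 ≠ v4 ∧ v2 ≠ v3 ∧ v2 ≠ v4 ∧ v3 ≠ v4)
    (hCstar : IsCycleE Cstar) (hCstarS : Cstar ⊆ S)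
    (hP : ({s(v1, v2), s(v2, v3), s(v3, v4)} : Finset (Sym2 V)) ⊆ Cstar)
    (hCstar2 : IsCycleE Cstar2) (hCstar2S : Cstar2 ⊆ S) (hne : Cstar2 ≠ Cstar)
    (hT : IsPathCoverE T') (hTe1 : s(v2, v3) ∈ T') (hTe2 : s(v3, v4) ∈ T')
    (hV1T : V1E T' = Set.univ \ {v3})
    (hf : f ∈ Cstar2) (hfT : f ∉ T') (hq : q ∈ f)
    (hins : IsPathCoverE (insert f T')) :
    ∃ S1 S2 T1 T2 : Finset (Sym2 V),
      IsPathCoverE S1 ∧ IsPathCoverE S2 ∧ IsPathCoverE T1 ∧ IsPathCoverE T2 ∧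
      (S1 ∪ T1 = S ∪ T') ∧ (S1 ∩ T1 = S ∩ T') ∧
      (S2 ∪ T2 = S ∪ T') ∧ (S2 ∩ T2 = S ∩ T') ∧
      ∃ A1 A2 B1 B2 : Finset (Sym2 V),
        Disjoint A1 A2 ∧ Disjoint A1 B1 ∧ Disjoint A1 B2 ∧
        Disjoint A2 B1 ∧ Disjoint A2 B2 ∧ Disjoint B1 B2 ∧
        Disjoint S1 A1 ∧ Disjoint S2 A2 ∧ Disjoint T1 B1 ∧ Disjoint T2 B2 ∧
        IsTourE (S1 ∪ A1) ∧ IsTourE (S2 ∪ A2) ∧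
        IsTourE (T1 ∪ B1) ∧ IsTourE (T2 ∪ B2) ∧
        (IsCycleE (A1 ∪ A2 ∪ B1 ∪ B2) ∨
          (∃ C1 C2 : Finset (Sym2 V), IsCycleE C1 ∧ IsCycleE C2 ∧
            Disjoint (VsetE C1) (VsetE C2) ∧ A1 ∪ A2 ∪ B1 ∪ B2 = C1 ∪ C2)) ∧
        VsetE (A1 ∪ A2 ∪ B1 ∪ B2) = Set.univ \ {v3} ∧
        (∃ D : Finset (Sym2 V), IsCycleE D ∧ VsetE D = Set.univ \ {v3} ∧
          s(q, v2) ∈ D ∧ lenE ℓ (A1 ∪ A2 ∪ B1 ∪ B2) ≤ lenE ℓ D) := by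
  obtain ⟨h12, h13, h14, h23, h24, h34⟩ := hdist
  obtain ⟨l, hl, hl3, hlC⟩ := isCycleE_iff.1 hCstar
  obtain ⟨l', hl', hl3', hlC'⟩ := isCycleE_iff.1 hCstar2
  have hTspan : ∀ v, ∃ e ∈ T', v ∈ e := fun v => by
    have : v ∈ VsetE T' := by
      rw [hT.2.1]
      trivial
    exact this
  obtain ⟨F, U, hF, hFU, hSv, hV⟩ :=
    exists_val_eq_add_of_cycleEdges hS hl hl3 hlC hl' hl3' hlC' hCstarS hCstar2S hne
  obtain ⟨P₀, hTv, hVT, hPe, hPm⟩ := exists_paths_of_isPathCoverE hT h23 h24 h34 hTe1 hTe2 hV1T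
  obtain ⟨q', rfl⟩ := Sym2.mem_iff_exists.1 hq
  have hqq : q ≠ q' := fun h => hins.1.1 _ (Finset.mem_insert_self _ _) (by simpa using h)
  rw [← Finset.mem_val, hlC'] at hf
  have hql := mem_of_mem_cycleEdges hf (Sym2.mem_mk_left q q')
  have hql' := mem_of_mem_cycleEdges hf (Sym2.mem_mk_right q q')
  obtain ⟨m, hm, hmc⟩ := exists_path_of_mem_cycleEdges hl' hl3' hf
  replace hP : ∀ e ∈ ({s(v1, v2), s(v2, v3), s(v3, v4)} : Finset (Sym2 V)), e ∈ cycleEdges l := by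
    intro e he
    rw [← hlC]
    exact hP he
  have hcyc := exists_of_mem_cycleEdges_of_mem_of_mem hl hl3 h14 h24 h13 (hP _ (by simp))
    (hP _ (by simp)) (hP _ (by simp))
  have hsub : {v2, v3, v4} ⊆ (l : Multiset V) := by
    rcases hcyc with ⟨h, -⟩ | ⟨p, -, h, -⟩ <;> intro v <;> rw [h] <;> simp <;> tauto
  have hnV : (Finset.univ.val : Multiset V).Nodup := Finset.univ.nodup
  have hnV' := hnV
  rw [hV, Multiset.nodup_add, Multiset.nodup_add] at hnV
  obtain ⟨⟨-, -, hd⟩, -, hd'⟩ := hnV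
  rw [Multiset.disjoint_left] at hd hd'
  have hP₀ : ∀ v, v ∉ (l : Multiset V) → v ∈ endSum P₀ := by
    intro v hv
    have : v ∈ vertSum P₀ + {v2, v3, v4} := by
      rw [← hVT]
      exact Finset.mem_univ v
    rw [hPe]
    exact (Multiset.mem_add.1 this).resolve_right fun h => hv (hsub h)
  have hnP₀ : (endSum P₀).Nodup := by
    rw [hVT, Multiset.nodup_add, ← hPe] at hnV'
    exact hnV'.1
  obtain ⟨P₁, hP₁e, hP₁v, hP₁s⟩ := exists_join (hP₀ q fun h => hd h hql)
    (hP₀ q' fun h => hd h hql') (by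
      rintro ⟨x, t, y⟩ hp hx hy
      obtain rfl : t = [] := hPm _ hp
      refine hfT ?_
      have hxy : s(x, y) ∈ T' := by
        rw [← Finset.mem_val, hTv]
        obtain ⟨P', rfl⟩ := Multiset.exists_cons_of_mem hp
        simp [edges, verts]
      rcases mem_ends.1 hx with rfl | rfl <;> rcases mem_ends.1 hy with rfl | rfl
      · exact absurd rfl hqq
      · exact hxy
      · rwa [Sym2.eq_swap]
      · exact absurd rfl hqq)
  obtain ⟨G, Q, L, hQe, hQv, hLe, hLv, hQL⟩ := exists_transfer (P := P₁) hF hFU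
    (by
      rw [← hP₁s] at hnP₀
      exact (Multiset.nodup_cons.1 (Multiset.nodup_cons.1 hnP₀).2).2)
    (by
      intro v hv
      have h := hP₀ v fun h => hd' (Multiset.mem_add.2 (Or.inl h)) hv
      rw [← hP₁s] at h
      refine (Multiset.mem_cons.1 ((Multiset.mem_cons.1 h).resolve_left ?_)).resolve_left ?_
      · rintro rfl
        exact hd' (Multiset.mem_add.2 (Or.inr hql)) hv
      · rintro rfl
        exact hd' (Multiset.mem_add.2 (Or.inr hql')) hv)
  obtain ⟨ls, rfl⟩ : ∃ ls : List (EndedPath V), (ls : Multiset _) = L := Quot.exists_rep L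
  have eS : S.val = cycleEdges l + (s(q, q') ::ₘ edges ⟨q, m, q'⟩) + (edgeSum ls + G) := by
    rw [hSv, hLe, hmc]
    rfl
  have eT : ∀ e, T'.val + ({e, s(q, q')} + G) = edgeSum Q + {s(v2, v3), s(v3, v4), e} := by
    intro e
    rw [hTv, hQe, hP₁e]
    simp only [Multiset.insert_eq_cons, ← Multiset.singleton_add]
    abel
  have vS : Finset.univ.val = (l : Multiset V) + ((verts ⟨q, m, q'⟩ : List V) : Multiset V) +
      vertSum (ls : Multiset _) := by
    rw [hV, hLv, Multiset.coe_eq_coe.2 hm]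
    rfl
  have vT : Finset.univ.val = vertSum Q + {v2, v3, v4} := by
    rw [hVT, hQv, hP₁v]
  have vC : Finset.univ.val =
      endSum Q + endSum (ls : Multiset _) + {q, q'} + {v2, v3, v4} := by
    rw [hVT, ← hPe, ← hP₁s, ← hQL]
    simp only [Multiset.insert_eq_cons, ← Multiset.singleton_add]
    abel
  have hQ : ∀ v ∈ l, v ∉ ({v2, v3, v4} : Multiset V) → v ∈ endSum Q := by
    intro v hv hv'
    have : v ∈ endSum Q + endSum (ls : Multiset _) + {q, q'} + {v2, v3, v4} := by
      rw [← vC]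
      exact Finset.mem_univ v
    rw [Multiset.mem_add, Multiset.mem_add, Multiset.mem_add, Multiset.insert_eq_cons,
      Multiset.mem_cons, Multiset.mem_singleton] at this
    rcases this with ((h | h) | rfl | rfl) | h
    · exact h
    · have := Multiset.mem_of_le (endSum_le_vertSum _) h
      rw [hLv] at this
      exact absurd this (hd' (Multiset.mem_add.2 (Or.inl hv)))
    · exact absurd hql (hd hv)
    · exact absurd hql' (hd hv)
    · exact absurd h hv'
  have hv1 : v1 ∈ endSum Q :=
    hQ v1 (mem_of_mem_cycleEdges (hP _ (by simp)) (Sym2.mem_mk_left v1 v2)) (by simp [*])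
  have hn3 : 3 < Fintype.card V := by omega
  clear * - hcyc eS eT vS vT vC hTspan hn3 hl hQ hv1
  rcases hcyc with ⟨hlv, hle⟩ | ⟨r, hr, hlv, hle⟩
  · obtain ⟨p, Q', hp, hp1, hp2, hp3⟩ := exists_cons_lst_eq hv1
    obtain ⟨qs, rfl⟩ : ∃ qs : List (EndedPath V), (qs : Multiset _) = Q' := Quot.exists_rep Q'
    rw [edgeSum_cons] at hp1
    rw [vertSum_cons] at hp2
    rw [endSum_cons, ends, hp] at hp3
    rw [hle] at eS
    rw [hlv] at vS
    obtain ⟨c, hcv, hce⟩ := exists_cycle_of_eq ls qs v1 v2 v4 q q' p.fst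
    have e₁ : edges ⟨v1, [v4, v3], v2⟩ = {s(v4, v1), s(v3, v4), s(v2, v3)} := by
      simp [edges, verts, Sym2.eq_swap]
    have e₂ : edges ⟨v4, [v3, v2], v1⟩ = {s(v3, v4), s(v2, v3), s(v1, v2)} := by
      simp [edges, verts, Sym2.eq_swap]
    have hv₁ : ((verts ⟨v1, [v4, v3], v2⟩ : List V) : Multiset V) = {v1, v4, v3, v2} := rfl
    have hv₂ : ((verts ⟨v4, [v3, v2], v1⟩ : List V) : Multiset V) = {v4, v3, v2, v1} := rfl
    refine exists_of_paths ℓ hn3 (g₁ := {s(v1, v2), s(q, q')} + G)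
      (g₂ := {s(v4, v1), s(q, q')} + G) (p := ⟨q, m, q'⟩) (p₁ := ⟨v1, [v4, v3], v2⟩)
      (p₂ := ⟨v4, [v3, v2], v1⟩) (r₁ := p.extend v2 v3 v4) (r₂ := p.extend v4 v3 v2)
      (ls := ls) (rs₁ := qs) (rs₂ := qs.map rev) (c := c) ?_ ?_ ?_ ?_ ?_ ?_ ?_ ?_ hce ?_ hTspan
    · rw [eS, e₁]
      simp only [Multiset.insert_eq_cons, ← Multiset.singleton_add]
      abel
    · rw [eS, e₂]
      simp only [Multiset.insert_eq_cons, ← Multiset.singleton_add]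
      abel
    · rw [eT, edges_extend, ← hp1, hp]
      simp only [Multiset.insert_eq_cons, ← Multiset.singleton_add]
      abel
    · rw [eT, edges_extend, ← hp1, hp, ← Multiset.map_coe, edgeSum_map_rev, Sym2.eq_swap (a := v1),
        Sym2.eq_swap (a := v3) (b := v4), Sym2.eq_swap (a := v3) (b := v2)]
      simp only [Multiset.insert_eq_cons, ← Multiset.singleton_add]
      abel
    · rw [vS, hv₁]
      simp only [Multiset.insert_eq_cons, ← Multiset.singleton_add]
      abel
    · rw [vS, hv₂]
      simp only [Multiset.insert_eq_cons, ← Multiset.singleton_add]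
      abel
    · rw [vT, coe_verts_extend, ← hp2]
      simp only [Multiset.insert_eq_cons, ← Multiset.singleton_add]
      abel
    · rw [vT, coe_verts_extend, ← hp2, ← Multiset.map_coe, vertSum_map_rev]
      simp only [Multiset.insert_eq_cons, ← Multiset.singleton_add]
      abel
    · rw [vC, hcv, ← hp3]
      simp only [Multiset.insert_eq_cons, ← Multiset.singleton_add]
      abel
  · rw [hle] at eS
    have hnl := hl
    rw [← Multiset.coe_nodup, hlv, Multiset.nodup_add] at hnl
    have hv5 : r.fst ∈ endSum Q := by
      refine hQ _ ?_ (Multiset.disjoint_left.1 hnl.2.2 (by simp [verts]))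
      rw [← Multiset.mem_coe, hlv]
      simp [verts]
    have h15 : r.fst ≠ v1 := by
      rintro h
      have := hnl.1
      simp [verts, h, hr] at this
    rw [hlv] at vS
    obtain ⟨p, Q', hp, hp1, hp2, hp3⟩ := exists_cons_lst_eq hv1
    rw [← hp3, endSum_cons, Multiset.mem_add, mem_ends, hp, or_iff_left h15] at hv5
    have hS₁ : S.val = (r.rev.extend v4 v3 v2).edges + edges ⟨q, m, q'⟩ +
        edgeSum (ls : Multiset _) + ({s(v1, v2), s(q, q')} + G) := by
      rw [eS, edges_extend, edges_rev, Sym2.eq_swap (a := v4), Sym2.eq_swap (a := v3) (b := v2),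
        Sym2.eq_swap (a := v4)]
      simp only [rev, Multiset.insert_eq_cons, ← Multiset.singleton_add]
      abel
    have hS₂ : S.val = (r.extend v2 v3 v4).edges + edges ⟨q, m, q'⟩ +
        edgeSum (ls : Multiset _) + ({s(v4, r.fst), s(q, q')} + G) := by
      rw [eS, edges_extend, hr]
      simp only [Multiset.insert_eq_cons, ← Multiset.singleton_add]
      abel
    have hV₁ : ((r.rev.extend v4 v3 v2).verts : Multiset V) +
        ((verts ⟨q, m, q'⟩ : List V) : Multiset V) + vertSum (ls : Multiset _) =
        Finset.univ.val := by
      rw [vS, coe_verts_extend, coe_verts_rev]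
      simp only [Multiset.insert_eq_cons, ← Multiset.singleton_add]
      abel
    have hV₂ : ((r.extend v2 v3 v4).verts : Multiset V) +
        ((verts ⟨q, m, q'⟩ : List V) : Multiset V) + vertSum (ls : Multiset _) =
        Finset.univ.val := by
      rw [vS, coe_verts_extend]
    rcases hv5 with hpf | hv5
    · obtain ⟨qs, rfl⟩ : ∃ qs : List (EndedPath V), (qs : Multiset _) = Q' := Quot.exists_rep Q'
      rw [edgeSum_cons] at hp1
      rw [vertSum_cons] at hp2
      rw [endSum_cons, ends, hp] at hp3
      obtain ⟨z, hz, hze⟩ := exists_path_of_ne ls qs v1 v2 v4 r.fst q q'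
      refine exists_of_paths ℓ hn3 hS₁ hS₂ (r₁ := p.extend v2 v3 v4)
        (r₂ := p.rev.extend v4 v3 v2) (rs₁ := qs) (rs₂ := qs.map rev) (c := v1 :: z)
        ?_ ?_ hV₁ hV₂ ?_ ?_ ?_ ?_ hTspan
      · rw [eT, edges_extend, ← hp1, hp]
        simp only [Multiset.insert_eq_cons, ← Multiset.singleton_add]
        abel
      · rw [eT, edges_extend, ← hp1, edges_rev, ← Multiset.map_coe, edgeSum_map_rev,
          Sym2.eq_swap (a := v4), Sym2.eq_swap (a := v3) (b := v2), Sym2.eq_swap (a := v4)]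
        simp only [rev, hpf, Multiset.insert_eq_cons, ← Multiset.singleton_add]
        abel
      · rw [vT, coe_verts_extend, ← hp2]
        simp only [Multiset.insert_eq_cons, ← Multiset.singleton_add]
        abel
      · rw [vT, coe_verts_extend, ← hp2, coe_verts_rev, ← Multiset.map_coe, vertSum_map_rev]
        simp only [Multiset.insert_eq_cons, ← Multiset.singleton_add]
        abel
      · refine (hze v1).trans ?_
        simp only [extend, rev, hr, hp, hpf]
      · rw [vC, ← Multiset.cons_coe, hz, ← hp3, hpf]
        simp only [Multiset.insert_eq_cons, ← Multiset.singleton_add]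
        abel
    · obtain ⟨p', Q'', hp', hp1', hp2', hp3'⟩ := exists_cons_lst_eq hv5
      obtain ⟨qs, rfl⟩ : ∃ qs : List (EndedPath V), (qs : Multiset _) = Q'' := Quot.exists_rep Q''
      rw [edgeSum_cons, ← hp1', edgeSum_cons] at hp1
      rw [vertSum_cons, ← hp2', vertSum_cons] at hp2
      rw [endSum_cons, ← hp3', endSum_cons, ends, ends, hp, hp'] at hp3
      obtain ⟨z, hz, hze⟩ := exists_path_of_ne ls qs v1 v2 v4 r.fst q q'
      refine exists_of_paths ℓ hn3 hS₁ hS₂ (r₁ := p.extend v2 v3 v4)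
        (r₂ := p'.extend v4 v3 v2) (rs₁ := qs ++ [p'.rev]) (rs₂ := qs.map rev ++ [p])
        (c := p.fst :: (z ++ [v1, p'.fst])) ?_ ?_ hV₁ hV₂ ?_ ?_ ?_ ?_ hTspan
      · rw [eT, edges_extend, ← hp1, hp, ← Multiset.coe_add, edgeSum_add, Multiset.coe_singleton,
          edgeSum_singleton, edges_rev]
        simp only [Multiset.insert_eq_cons, ← Multiset.singleton_add]
        abel
      · rw [eT, edges_extend, ← hp1, hp', ← Multiset.coe_add, edgeSum_add, Multiset.coe_singleton,
          edgeSum_singleton, ← Multiset.map_coe, edgeSum_map_rev,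
          Sym2.eq_swap (a := v4), Sym2.eq_swap (a := v3) (b := v2), Sym2.eq_swap (a := v4)]
        simp only [Multiset.insert_eq_cons, ← Multiset.singleton_add]
        abel
      · rw [vT, coe_verts_extend, ← hp2, ← Multiset.coe_add, vertSum_add, Multiset.coe_singleton,
          vertSum_singleton, coe_verts_rev]
        simp only [Multiset.insert_eq_cons, ← Multiset.singleton_add]
        abel
      · rw [vT, coe_verts_extend, ← hp2, ← Multiset.coe_add, vertSum_add, Multiset.coe_singleton,
          vertSum_singleton, ← Multiset.map_coe, vertSum_map_rev]
        simp only [Multiset.insert_eq_cons, ← Multiset.singleton_add]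
        abel
      · have := pathEdges_append (p.fst :: z) v1 [p'.fst, p.fst]
        simp only [List.cons_append] at this
        rw [links_append_singleton, links_append_singleton]
        change pathEdges (p.fst :: ((z ++ [v1, p'.fst]) ++ [p.fst])) = _
        rw [List.append_assoc]
        change pathEdges (p.fst :: (z ++ [v1, p'.fst, p.fst])) = _
        rw [this, hze]
        simp only [extend, rev, hr, hp, hp', pathEdges_cons_cons, pathEdges_singleton,
          ← Multiset.singleton_add]
        abel
      · rw [vC, ← Multiset.cons_coe, ← Multiset.coe_add, hz, ← hp3]
        simp only [← Multiset.cons_coe, Multiset.coe_nil, Multiset.insert_eq_cons,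
          ← Multiset.singleton_add]
        abel
end

section
/- Suppose n ≥ 5 is odd, and let P = {(v1,v2), (v2,v3), (v3,v4)} with v1, v2, v3, v4 distinct. Let S be a minimum-length 2-factor of G among all 2-factors containing P; let T be a minimum-length path cover among all path covers with (v1,v2), (v2,v3) ∈ T and V1(T) = V \ {v2}; and let T′ be a minimum-length path cover among all path covers with (v2,v3), (v3,v4) ∈ T′ and V1(T′) = V \ {v3}. If some tour of G of minimum length contains P, then 2ℓ(S) + ℓ(T) + ℓ(T′) ≤ 3·opt(G,ℓ) + ℓ(v2, v3). -/
variable {V : Type*} [Fintype V] [DecidableEq V]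

/-- The successor of `i` in the cyclic order on `{0, …, n - 1}`. -/
def cycSucc (n i : ℕ) : ℕ := if i + 1 = n then 0 else i + 1

/-- The `i`-th edge of the closed walk `g 0, …, g (n - 1)`. -/
def cycEdge (n : ℕ) (g : ℕ → V) (i : ℕ) : Sym2 V := s(g i, g (cycSucc n i))

theorem cycEdge_injOn {n : ℕ} (hn : 3 ≤ n) {g : ℕ → V}
    (hg : ∀ i < n, ∀ j < n, g i = g j → i = j) :
    ∀ i < n, ∀ j < n, cycEdge n g i = cycEdge n g j → i = j := by
  intro i hi j hj h
  have hsi : cycSucc n i < n := by unfold cycSucc; split_ifs <;> omega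
  have hsj : cycSucc n j < n := by unfold cycSucc; split_ifs <;> omega
  rcases Sym2.eq_iff.1 h with ⟨h1, -⟩ | ⟨h1, h2⟩
  · exact hg _ hi _ hj h1
  · have h1 := hg _ hi _ hsj h1
    have h2 := hg _ hsi _ hj h2
    unfold cycSucc at h1 h2
    split_ifs at h1 h2 <;> omega

theorem mem_cycEdge_iff {n : ℕ} {g : ℕ → V}
    (hg : ∀ i < n, ∀ j < n, g i = g j → i = j) {i j : ℕ} (hi : i < n) (hj : j < n) :
    g j ∈ cycEdge n g i ↔ j = i ∨ j = cycSucc n i := by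
  have hsi : cycSucc n i < n := by unfold cycSucc; split_ifs <;> omega
  rw [cycEdge, Sym2.mem_iff]
  exact or_congr ⟨hg _ hj _ hi, fun h => h ▸ rfl⟩ ⟨hg _ hj _ hsi, fun h => h ▸ rfl⟩

theorem degE_image_cycEdge {n : ℕ} (hn : 3 ≤ n) {g : ℕ → V}
    (hg : ∀ i < n, ∀ j < n, g i = g j → i = j) {I : Finset ℕ} (hI : ∀ i ∈ I, i < n)
    {j : ℕ} (hj : j < n) :
    degE (I.image (cycEdge n g)) (g j) = (I.filter (fun i => j = i ∨ j = cycSucc n i)).card := by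
  rw [degE, Finset.filter_image, Finset.card_image_of_injOn]
  · congr 1
    exact Finset.filter_congr fun i hi => mem_cycEdge_iff hg (hI i hi) hj
  · intro a ha b hb hab
    exact cycEdge_injOn hn hg a (hI a (Finset.mem_filter.1 ha).1) b
      (hI b (Finset.mem_filter.1 hb).1) hab

theorem simpleE_image_cycEdge {n : ℕ} (hn : 3 ≤ n) {g : ℕ → V}
    (hg : ∀ i < n, ∀ j < n, g i = g j → i = j) {I : Finset ℕ} (hI : ∀ i ∈ I, i < n) :
    SimpleE (I.image (cycEdge n g)) := by
  intro e he
  obtain ⟨i, hi, rfl⟩ := Finset.mem_image.1 he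
  have hi := hI i hi
  have hsi : cycSucc n i < n := by unfold cycSucc; split_ifs <;> omega
  rw [cycEdge, Sym2.mk_isDiag_iff]
  intro h
  have h := hg _ hi _ hsi h
  unfold cycSucc at h
  split_ifs at h <;> omega

theorem lenE_image_cycEdge {n : ℕ} (hn : 3 ≤ n) {g : ℕ → V}
    (hg : ∀ i < n, ∀ j < n, g i = g j → i = j) (ℓ : Sym2 V → ℝ)
    {I : Finset ℕ} (hI : ∀ i ∈ I, i < n) :
    lenE ℓ (I.image (cycEdge n g)) = ∑ i ∈ I, ℓ (cycEdge n g i) := by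
  rw [lenE, Finset.sum_image]
  intro a ha b hb hab
  exact cycEdge_injOn hn hg a (hI a ha) b (hI b hb) hab

/-- Two distinct edges at `v` force degree at least two. -/
theorem two_le_degE {F : Finset (Sym2 V)} {u v w : V} (huw : u ≠ w)
    (hu : s(u, v) ∈ F) (hw : s(v, w) ∈ F) : 2 ≤ degE F v := by
  refine Finset.one_lt_card.2 ⟨s(u, v), by simp [hu], s(v, w), by simp [hw], ?_⟩
  intro h
  rcases Sym2.eq_iff.1 h with ⟨h1, h2⟩ | ⟨h1, -⟩
  · exact huw (h1.trans h2)
  · exact huw h1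

/-- An edge set in which all vertices but one have degree one contains no cycle. -/
theorem acyclicE_of_degE_eq_one {F : Finset (Sym2 V)} {v : V}
    (h : ∀ u, u ≠ v → degE F u = 1) : AcyclicE F := by
  rintro C hC ⟨m, hm, f, hf, rfl⟩
  have hmem : ∀ i < m, s(f i, f ((i + 1) % m)) ∈ F := fun i hi =>
    hC (Finset.mem_image.2 ⟨i, Finset.mem_range.2 hi, rfl⟩)
  have h0 := hmem 0 (by omega)
  have h1 := hmem 1 (by omega)
  have h2 := hmem 2 (by omega)
  rw [Nat.mod_eq_of_lt (by omega)] at h0 h1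
  have hlt : (2 + 1) % m < m := Nat.mod_lt _ (by omega)
  have hne : f 1 ≠ f ((2 + 1) % m) := by
    intro heq
    have := hf _ (by omega) _ hlt heq
    rcases Nat.lt_or_ge 3 m with h3 | h3
    · rw [Nat.mod_eq_of_lt h3] at this; omega
    · obtain rfl : m = 3 := by omega
      simp at this
  have d1 : 2 ≤ degE F (f 1) := two_le_degE
    (fun h' => by have := hf _ (by omega) _ (by omega) h'; omega) h0 h1
  have d2 : 2 ≤ degE F (f 2) := two_le_degE hne h1 h2
  by_cases hv : f 1 = v
  · have hv2 : f 2 ≠ v := fun h' => by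
      have := hf 1 (by omega) 2 (by omega) (hv.trans h'.symm); omega
    have := h _ hv2; omega
  · have := h _ hv; omega

/-- Degree two at `v` and degree one elsewhere characterise the path covers we need. -/
theorem isPathCoverE_of_degE {F : Finset (Sym2 V)} {v : V} (hF : SimpleE F)
    (hv : degE F v = 2) (h : ∀ u, u ≠ v → degE F u = 1) :
    IsPathCoverE F ∧ V1E F = Set.univ \ {v} := by
  refine ⟨⟨⟨hF, fun u => ?_⟩, ?_, acyclicE_of_degE_eq_one h⟩, ?_⟩
  · by_cases hu : u = v
    · rw [hu, hv]
    · rw [h u hu]; omega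
  · refine Set.eq_univ_of_forall fun u => ?_
    have hpos : 0 < degE F u := by
      by_cases hu : u = v
      · rw [hu, hv]; omega
      · rw [h u hu]; omega
    obtain ⟨e, he⟩ := Finset.card_pos.1 hpos
    exact ⟨e, (Finset.mem_filter.1 he).1, (Finset.mem_filter.1 he).2⟩
  · ext u
    simp only [V1E, Set.mem_ofPred_eq, Set.mem_sdiff, Set.mem_univ, true_and, Set.mem_singleton_iff]
    refine ⟨?_, h u⟩
    rintro hu rfl
    omega

/-- A tour, traversed along `ZMod n`. -/
theorem IsTourE.exists_zmod {H : Finset (Sym2 V)} (hH : IsTourE H) :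
    ∃ n : ℕ, 3 ≤ n ∧ n = Fintype.card V ∧ ∃ f : ZMod n → V, Function.Bijective f ∧
      ∀ e, e ∈ H ↔ ∃ x, e = s(f x, f (x + 1)) := by
  obtain ⟨⟨n, hn, f, hf, hHf⟩, hspan⟩ := hH
  have : NeZero n := ⟨by omega⟩
  have : Fact (1 < n) := ⟨by omega⟩
  have hmem : ∀ e, e ∈ H ↔ ∃ x : ZMod n, e = s(f x.val, f (x + 1).val) := by
    intro e
    rw [hHf, Finset.mem_image]
    constructor
    · rintro ⟨i, hi, rfl⟩
      have hi := Finset.mem_range.1 hi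
      refine ⟨(i : ZMod n), ?_⟩
      rw [ZMod.val_add, ZMod.val_one, ZMod.val_cast_of_lt hi]
    · rintro ⟨x, rfl⟩
      refine ⟨x.val, Finset.mem_range.2 x.val_lt, ?_⟩
      rw [ZMod.val_add, ZMod.val_one]
  have hbij : Function.Bijective (fun x : ZMod n => f x.val) := by
    refine ⟨fun x y hxy => ZMod.val_injective n (hf _ x.val_lt _ y.val_lt hxy), fun v => ?_⟩
    have hv : v ∈ VsetE H := by rw [show VsetE H = Set.univ from hspan]; trivial
    obtain ⟨e, he, hve⟩ := hv
    obtain ⟨x, rfl⟩ := (hmem e).1 he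
    rcases Sym2.mem_iff.1 hve with h | h
    · exact ⟨x, h.symm⟩
    · exact ⟨x + 1, h.symm⟩
  refine ⟨n, hn, ?_, _, hbij, hmem⟩
  rw [← Fintype.card_of_bijective hbij, ZMod.card]

/-- A tour through the path `v1, v2, v3, v4` can be traversed starting with that path. -/
theorem IsTourE.exists_traversal {H : Finset (Sym2 V)} (hH : IsTourE H) {v1 v2 v3 v4 : V}
    (h13 : v1 ≠ v3) (h24 : v2 ≠ v4) (h12 : s(v1, v2) ∈ H) (h23 : s(v2, v3) ∈ H)
    (h34 : s(v3, v4) ∈ H) :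
    ∃ g : ℕ → V, (∀ i < Fintype.card V, ∀ j < Fintype.card V, g i = g j → i = j) ∧
      (∀ v, ∃ i < Fintype.card V, g i = v) ∧
      H = (Finset.range (Fintype.card V)).image (cycEdge (Fintype.card V) g) ∧
      g 0 = v1 ∧ g 1 = v2 ∧ g 2 = v3 ∧ g 3 = v4 := by
  obtain ⟨n, hn, hcard, f, hf, hmem⟩ := hH.exists_zmod
  rw [← hcard]
  have : NeZero n := ⟨by omega⟩
  suffices ∃ f' : ZMod n → V, Function.Bijective f' ∧ (∀ e, e ∈ H ↔ ∃ x, e = s(f' x, f' (x + 1))) ∧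
      f' 0 = v1 ∧ f' 1 = v2 ∧ f' 2 = v3 ∧ f' 3 = v4 by
    obtain ⟨f', hf', hmem', h0, h1, h2, h3⟩ := this
    have hsucc : ∀ i : ℕ, ((cycSucc n i : ℕ) : ZMod n) = i + 1 := by
      intro i
      unfold cycSucc
      split_ifs with h
      · have : ((i + 1 : ℕ) : ZMod n) = 0 := by rw [h]; simp
        push_cast at this ⊢
        exact this.symm
      · push_cast; rfl
    refine ⟨fun i => f' i, ?_, ?_, ?_, by simpa using h0, by simpa using h1, by simpa using h2,
      by simpa using h3⟩
    · intro i hi j hj hij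
      have := congrArg ZMod.val (hf'.1 hij)
      rwa [ZMod.val_cast_of_lt hi, ZMod.val_cast_of_lt hj] at this
    · intro v
      obtain ⟨x, rfl⟩ := hf'.2 v
      exact ⟨x.val, x.val_lt, by simp⟩
    · ext e
      rw [hmem', Finset.mem_image]
      constructor
      · rintro ⟨x, rfl⟩
        exact ⟨x.val, Finset.mem_range.2 x.val_lt, by simp [cycEdge, hsucc]⟩
      · rintro ⟨i, -, rfl⟩
        exact ⟨i, by simp [cycEdge, hsucc]⟩
  have key : ∀ u b, s(f b, u) ∈ H → u = f (b + 1) ∨ u = f (b - 1) := by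
    intro u b h
    obtain ⟨x, hx⟩ := (hmem _).1 h
    rcases Sym2.eq_iff.1 hx with ⟨h1, h2⟩ | ⟨h1, h2⟩
    · exact Or.inl (by rw [h2, hf.1 h1])
    · exact Or.inr (by rw [h2, hf.1 h1]; simp)
  obtain ⟨b, rfl⟩ := hf.2 v2
  rw [Sym2.eq_swap] at h12
  rcases key _ _ h12 with rfl | rfl <;> rcases key _ _ h23 with rfl | rfl
  · exact absurd rfl h13
  · rcases key _ _ h34 with rfl | rfl
    · exact absurd (by simp) h24
    · refine ⟨fun x => f (b + 1 - x), hf.comp (Equiv.subLeft (b + 1)).bijective, fun e => ?_,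
        by simp, by simp, ?_, ?_⟩
      · rw [hmem]
        constructor
        · rintro ⟨x, rfl⟩
          refine ⟨b - x, ?_⟩
          rw [Sym2.eq_swap]
          exact congrArg₂ (fun u w => s(f u, f w)) (by ring) (by ring)
        · rintro ⟨x, rfl⟩
          refine ⟨b - x, ?_⟩
          rw [Sym2.eq_swap]
          exact congrArg₂ (fun u w => s(f u, f w)) (by ring) (by ring)
      · exact congrArg f (by ring)
      · exact congrArg f (by ring)
  · rcases key _ _ h34 with rfl | rfl
    · refine ⟨fun x => f (b - 1 + x), hf.comp (Equiv.addLeft (b - 1)).bijective, fun e => ?_,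
        by simp, by simp, ?_, ?_⟩
      · rw [hmem]
        constructor
        · rintro ⟨x, rfl⟩
          refine ⟨x - b + 1, ?_⟩
          exact congrArg₂ (fun u w => s(f u, f w)) (by ring) (by ring)
        · rintro ⟨x, rfl⟩
          refine ⟨b - 1 + x, ?_⟩
          exact congrArg₂ (fun u w => s(f u, f w)) (by ring) (by ring)
      · exact congrArg f (by ring)
      · exact congrArg f (by ring)
    · exact absurd (by simp) h24
  · exact absurd rfl h13

/-- Lemma 17 of the paper. -/
theorem stmt16 (ℓ : Sym2 V → ℝ) (hℓ : ∀ e : Sym2 V, 0 ≤ ℓ e)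
    (hn : 5 ≤ Fintype.card V) (hodd : Odd (Fintype.card V))
    (S T T' : Finset (Sym2 V)) (v1 v2 v3 v4 : V)
    (hdist : v1 ≠ v2 ∧ v1 ≠ v3 ∧ v1 ≠ v4 ∧ v2 ≠ v3 ∧ v2 ≠ v4 ∧ v3 ≠ v4)
    (hS : IsKFactor 2 S)
    (hPS : ({s(v1, v2), s(v2, v3), s(v3, v4)} : Finset (Sym2 V)) ⊆ S)
    (hSmin : ∀ S' : Finset (Sym2 V), IsKFactor 2 S' →
      ({s(v1, v2), s(v2, v3), s(v3, v4)} : Finset (Sym2 V)) ⊆ S' → lenE ℓ S ≤ lenE ℓ S')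
    (hT : IsPathCoverE T) (hT12 : s(v1, v2) ∈ T) (hT23 : s(v2, v3) ∈ T)
    (hV1T : V1E T = Set.univ \ {v2})
    (hTmin : ∀ U : Finset (Sym2 V), IsPathCoverE U → s(v1, v2) ∈ U → s(v2, v3) ∈ U →
      V1E U = Set.univ \ {v2} → lenE ℓ T ≤ lenE ℓ U)
    (hT' : IsPathCoverE T') (hT'23 : s(v2, v3) ∈ T') (hT'34 : s(v3, v4) ∈ T')
    (hV1T' : V1E T' = Set.univ \ {v3})
    (hT'min : ∀ U : Finset (Sym2 V), IsPathCoverE U → s(v2, v3) ∈ U → s(v3, v4) ∈ U →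
      V1E U = Set.univ \ {v3} → lenE ℓ T' ≤ lenE ℓ U)
    (hopt : ∃ H : Finset (Sym2 V), IsTourE H ∧ lenE ℓ H = optE ℓ ∧
      ({s(v1, v2), s(v2, v3), s(v3, v4)} : Finset (Sym2 V)) ⊆ H) :
    2 * lenE ℓ S + lenE ℓ T + lenE ℓ T' ≤ 3 * optE ℓ + ℓ s(v2, v3) := by
  obtain ⟨H, hH, hHlen, hPH⟩ := hopt
  obtain ⟨h12, h13, h14, h23, h24, h34⟩ := hdist
  obtain ⟨g, hg, hsurj, hHg, g0, g1, g2, g3⟩ := hH.exists_traversal h13 h24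
    (hPH (by simp)) (hPH (by simp)) (hPH (by simp))
  rw [← hHlen]
  generalize Fintype.card V = n at *
  have hn3 : 3 ≤ n := by omega
  have hodd2 : n % 2 = 1 := Nat.odd_iff.1 hodd
  have hR : ∀ i ∈ Finset.range n, i < n := fun i hi => Finset.mem_range.1 hi
  have hSH : lenE ℓ S ≤ lenE ℓ H := by
    refine hSmin H ⟨hHg ▸ simpleE_image_cycEdge hn3 hg hR, fun v => ?_⟩ hPH
    obtain ⟨j, hj, rfl⟩ := hsurj v
    rw [hHg, degE_image_cycEdge hn3 hg hR hj, Finset.card_eq_two]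
    refine ⟨j, if j = 0 then n - 1 else j - 1, by split_ifs <;> omega, ?_⟩
    ext i
    simp only [Finset.mem_filter, Finset.mem_range, Finset.mem_insert, Finset.mem_singleton]
    unfold cycSucc
    split_ifs <;> omega
  have e0 : cycEdge n g 0 = s(v1, v2) := by
    rw [cycEdge, cycSucc, if_neg (by omega), g0, g1]
  have e1 : cycEdge n g 1 = s(v2, v3) := by
    rw [cycEdge, cycSucc, if_neg (by omega), g1, g2]
  have e2 : cycEdge n g 2 = s(v3, v4) := by
    rw [cycEdge, cycSucc, if_neg (by omega), g2, g3]
  set I := (Finset.range n).filter (fun i => i = 0 ∨ i % 2 = 1)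
  set I' := (Finset.range n).filter (fun i => i = 1 ∨ (i ≠ 0 ∧ i % 2 = 0))
  have hI : ∀ i ∈ I, i < n := fun i hi => hR i (Finset.mem_filter.1 hi).1
  have hI' : ∀ i ∈ I', i < n := fun i hi => hR i (Finset.mem_filter.1 hi).1
  have hTI : lenE ℓ T ≤ ∑ i ∈ I, ℓ (cycEdge n g i) := by
    rw [← lenE_image_cycEdge hn3 hg ℓ hI]
    have hU := isPathCoverE_of_degE (v := v2) (simpleE_image_cycEdge hn3 hg hI) ?_ ?_
    · refine hTmin _ hU.1 ?_ ?_ hU.2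
      · rw [← e0]; exact Finset.mem_image_of_mem _ (by simp [I]; omega)
      · rw [← e1]; exact Finset.mem_image_of_mem _ (by simp [I]; omega)
    · rw [← g1, degE_image_cycEdge hn3 hg hI (by omega), Finset.card_eq_two]
      refine ⟨0, 1, by omega, ?_⟩
      ext i
      simp only [I, Finset.mem_filter, Finset.mem_range, Finset.mem_insert, Finset.mem_singleton]
      unfold cycSucc
      split_ifs <;> omega
    · intro u hu
      obtain ⟨j, hj, rfl⟩ := hsurj u
      have hj1 : j ≠ 1 := by rintro rfl; exact hu g1
      rw [degE_image_cycEdge hn3 hg hI hj, Finset.card_eq_one]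
      refine ⟨if j = 0 ∨ j % 2 = 1 then j else j - 1, ?_⟩
      ext i
      simp only [I, Finset.mem_filter, Finset.mem_range, Finset.mem_singleton]
      unfold cycSucc
      split_ifs <;> omega
  have hTI' : lenE ℓ T' ≤ ∑ i ∈ I', ℓ (cycEdge n g i) := by
    rw [← lenE_image_cycEdge hn3 hg ℓ hI']
    have hU := isPathCoverE_of_degE (v := v3) (simpleE_image_cycEdge hn3 hg hI') ?_ ?_
    · refine hT'min _ hU.1 ?_ ?_ hU.2
      · rw [← e1]; exact Finset.mem_image_of_mem _ (by simp [I']; omega)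
      · rw [← e2]; exact Finset.mem_image_of_mem _ (by simp [I']; omega)
    · rw [← g2, degE_image_cycEdge hn3 hg hI' (by omega), Finset.card_eq_two]
      refine ⟨1, 2, by omega, ?_⟩
      ext i
      simp only [I', Finset.mem_filter, Finset.mem_range, Finset.mem_insert, Finset.mem_singleton]
      unfold cycSucc
      grind
    · intro u hu
      obtain ⟨j, hj, rfl⟩ := hsurj u
      have hj2 : j ≠ 2 := by rintro rfl; exact hu g2
      rw [degE_image_cycEdge hn3 hg hI' hj, Finset.card_eq_one]
      refine ⟨if j = 0 then n - 1 else if j = 1 ∨ j % 2 = 0 then j else j - 1, ?_⟩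
      ext i
      simp only [I', Finset.mem_filter, Finset.mem_range, Finset.mem_singleton]
      unfold cycSucc
      split_ifs <;> omega
  have hsum : ∑ i ∈ I, ℓ (cycEdge n g i) + ∑ i ∈ I', ℓ (cycEdge n g i)
      = lenE ℓ H + ℓ s(v2, v3) := by
    rw [hHg, lenE_image_cycEdge hn3 hg ℓ hR, ← Finset.sum_union_inter]
    congr 1
    · refine Finset.sum_congr ?_ fun _ _ => rfl
      ext i
      simp only [I, I', Finset.mem_union, Finset.mem_filter, Finset.mem_range]
      omega
    · have : I ∩ I' = {1} := by
        ext i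
        simp only [I, I', Finset.mem_inter, Finset.mem_filter, Finset.mem_range,
          Finset.mem_singleton]
        omega
      rw [this, Finset.sum_singleton, e1]
  linarith
end
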